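/- arXiv:math/0606428 — 2 statements merged into one kernel-verified Lean document; each statement's English description precedes it below -/
import Mathlib

section
/- Let z : ℝ × [0,T) → ℂ \ {0} be a smooth solution of the equivariant flow (*), 2π-periodic and regular in φ for each t. If the initial curve is tamed, i.e. f(φ,0) > 0 for all φ, then f(φ,t) > 0 for all φ ∈ ℝ and all t ∈ [0,T). -/
open Real Set

/-- Euclidean inner product on ℂ ≅ ℝ²: ⟨a,b⟩ = Re(conj a · b). -/
noncomputable def ip (a b : ℂ) : ℝ := a.re * b.re + a.im * b.im

/-- Outward unit normal ν = (∂_φ v − i ∂_φ u)/√g of a regular curve z = u + iv. -/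
noncomputable def nu (z : ℝ → ℂ) (φ : ℝ) : ℂ :=
  (‖deriv z φ‖)⁻¹ • (⟨(deriv z φ).im, -(deriv z φ).re⟩ : ℂ)

/-- Curvature k = (u'v'' − v'u'')/g^{3/2}. -/
noncomputable def curv (z : ℝ → ℂ) (φ : ℝ) : ℝ :=
  ((deriv z φ).re * (deriv (deriv z) φ).im -
    (deriv z φ).im * (deriv (deriv z) φ).re) / ‖deriv z φ‖ ^ 3

/-- f = k + (n−1)⟨z,ν⟩/|z|². -/
noncomputable def fq (n : ℕ) (z : ℝ → ℂ) (φ : ℝ) : ℝ :=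
  curv z φ + ((n : ℝ) - 1) * ip (z φ) (nu z φ) / ‖z φ‖ ^ 2

/-- Tangential Laplacian Δh = (1/√g)∂_φ(∂_φ h/√g) along the curve z. -/
noncomputable def lap (z : ℝ → ℂ) (h : ℝ → ℝ) (φ : ℝ) : ℝ :=
  (deriv (fun ψ => deriv h ψ / ‖deriv z ψ‖) φ) / ‖deriv z φ‖

/-- ⟨ν, e_r⟩ = ⟨z,ν⟩/|z|. -/
noncomputable def ner (z : ℝ → ℂ) (φ : ℝ) : ℝ := ip (z φ) (nu z φ) / ‖z φ‖

section PartialDerivatives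

variable {E : Type*} [NormedAddCommGroup E] [NormedSpace ℝ E] {G : ℝ → ℝ → E}

lemma hasDerivAt_snd_of_contDiff (hG : ContDiff ℝ (⊤ : ℕ∞) (fun p : ℝ × ℝ => G p.1 p.2))
    (t φ : ℝ) :
    HasDerivAt (G t) (fderiv ℝ (fun p : ℝ × ℝ => G p.1 p.2) (t, φ) (0, 1)) φ := by
  have h := (hG.differentiable (by simp) (t, φ)).hasFDerivAt
  exact h.comp_hasDerivAt φ ((hasDerivAt_const φ t).prodMk (hasDerivAt_id φ))

lemma hasDerivAt_fst_of_contDiff (hG : ContDiff ℝ (⊤ : ℕ∞) (fun p : ℝ × ℝ => G p.1 p.2))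
    (t φ : ℝ) :
    HasDerivAt (fun s => G s φ) (fderiv ℝ (fun p : ℝ × ℝ => G p.1 p.2) (t, φ) (1, 0)) t := by
  have h := (hG.differentiable (by simp) (t, φ)).hasFDerivAt
  exact h.comp_hasDerivAt t ((hasDerivAt_id t).prodMk (hasDerivAt_const t φ))

lemma contDiff_fderiv_apply {F : ℝ × ℝ → E} (hF : ContDiff ℝ (⊤ : ℕ∞) F) (v : ℝ × ℝ) :
    ContDiff ℝ (⊤ : ℕ∞) (fun p => fderiv ℝ F p v) :=
  (hF.fderiv_right (m := (⊤ : ℕ∞)) (by simp)).clm_apply contDiff_const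

lemma contDiff_deriv_snd (hG : ContDiff ℝ (⊤ : ℕ∞) (fun p : ℝ × ℝ => G p.1 p.2)) :
    ContDiff ℝ (⊤ : ℕ∞) (fun p : ℝ × ℝ => deriv (G p.1) p.2) := by
  have h : (fun p : ℝ × ℝ => deriv (G p.1) p.2)
      = fun p => fderiv ℝ (fun p : ℝ × ℝ => G p.1 p.2) p (0, 1) :=
    funext fun p => (hasDerivAt_snd_of_contDiff hG p.1 p.2).deriv
  rw [h]
  exact contDiff_fderiv_apply hG _

lemma hasDerivAt_deriv_comm (hG : ContDiff ℝ (⊤ : ℕ∞) (fun p : ℝ × ℝ => G p.1 p.2))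
    (t φ : ℝ) :
    HasDerivAt (fun s => deriv (G s) φ)
      (deriv (fun ψ => deriv (fun s => G s ψ) t) φ) t := by
  set F : ℝ × ℝ → E := fun p => G p.1 p.2 with hF
  have h1 : (fun s => deriv (G s) φ) = fun s => fderiv ℝ F (s, φ) (0, 1) :=
    funext fun s => (hasDerivAt_snd_of_contDiff hG s φ).deriv
  have h2 : (fun ψ => deriv (fun s => G s ψ) t) = fun ψ => fderiv ℝ F (t, ψ) (1, 0) :=
    funext fun ψ => (hasDerivAt_fst_of_contDiff hG t ψ).deriv
  have hd : DifferentiableAt ℝ (fderiv ℝ F) (t, φ) :=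
    (hG.fderiv_right (m := (⊤ : ℕ∞)) (by simp)).differentiable (by simp) _
  have h3 := hasDerivAt_fst_of_contDiff
    (G := fun s ψ => fderiv ℝ F (s, ψ) (0, 1)) (contDiff_fderiv_apply hG (0, 1)) t φ
  have h4 := hasDerivAt_snd_of_contDiff
    (G := fun s ψ => fderiv ℝ F (s, ψ) (1, 0)) (contDiff_fderiv_apply hG (1, 0)) t φ
  have hsymm : IsSymmSndFDerivAt ℝ F (t, φ) :=
    hG.contDiffAt.isSymmSndFDerivAt (by simpa using WithTop.coe_le_coe.2 (le_top : (2 : ℕ∞) ≤ ⊤))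
  rw [h1, h2, h4.deriv]
  convert h3 using 1
  simp only [Prod.mk.eta]
  rw [fderiv_clm_apply hd (by fun_prop), fderiv_clm_apply hd (by fun_prop)]
  simpa using hsymm (0, 1) (1, 0)

end PartialDerivatives

/-- A periodic function that is positive at time `0` and decays at most exponentially at its
spatial minima stays positive. -/
lemma pos_of_decay_at_minima {F : ℝ → ℝ → ℝ} {P b C : ℝ} (hP : 0 < P)
    (hcont : ContinuousOn (fun p : ℝ × ℝ => F p.1 p.2) (Icc 0 b ×ˢ univ))
    (hper : ∀ t ∈ Icc 0 b, ∀ φ, F t (φ + P) = F t φ)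
    (h0 : ∀ φ, 0 < F 0 φ)
    (hmin : ∀ t ∈ Ioc 0 b, ∀ φ, 0 < F t φ → (∀ ψ, F t φ ≤ F t ψ) →
      ∃ F', HasDerivAt (fun s => F s φ) F' t ∧ -C * F t φ < F') :
    ∀ t ∈ Icc 0 b, ∀ φ, 0 < F t φ := by
  intro t₁ ht₁ φ₁
  have hb : 0 ≤ b := ht₁.1.trans ht₁.2
  have h0b : (0 : ℝ) ∈ Icc 0 b := ⟨le_rfl, hb⟩
  have hred : ∀ t ∈ Icc 0 b, ∀ φ, ∃ ψ ∈ Icc 0 P, F t φ = F t ψ := by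
    intro t ht φ
    obtain ⟨ψ, hψ, h⟩ := Function.Periodic.exists_mem_Ico₀ (f := F t) (hper t ht) hP φ
    exact ⟨ψ, Ico_subset_Icc_self hψ, h⟩
  set H : ℝ × ℝ → ℝ := fun p => Real.exp (C * p.1) * F p.1 p.2 with hH
  have hHc : ContinuousOn H (Icc 0 b ×ˢ univ) :=
    (Continuous.continuousOn (by fun_prop)).mul hcont
  have hslice : ∀ φ, ContinuousOn (fun s => H (s, φ)) (Icc 0 b) := fun φ =>
    hHc.comp (f := fun s : ℝ => (s, φ)) (Continuous.continuousOn (by fun_prop))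
      fun s hs => ⟨hs, mem_univ _⟩
  obtain ⟨φm, -, hφm⟩ := (isCompact_Icc (a := (0 : ℝ)) (b := P)).exists_isMinOn
    (f := F 0) ⟨0, le_rfl, hP.le⟩
    (hcont.comp (f := fun ψ : ℝ => ((0 : ℝ), ψ)) (Continuous.continuousOn (by fun_prop))
      fun s _ => ⟨h0b, mem_univ _⟩)
  set m := F 0 φm / 2 with hm
  have hmpos : 0 < m := half_pos (h0 φm)
  have hH0 : ∀ φ, m < H (0, φ) := by
    intro φ
    obtain ⟨ψ, hψ, h⟩ := hred 0 h0b φ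
    have := hφm hψ
    have h2 := h0 φm
    simp only [mem_ofPred_eq] at this
    simp only [hH, mul_zero, Real.exp_zero, one_mul]
    linarith
  suffices hall : ∀ t ∈ Icc 0 b, ∀ φ, m < H (t, φ) by
    have := hmpos.trans (hall t₁ ht₁ φ₁)
    exact pos_of_mul_pos_right this (Real.exp_pos _).le
  by_contra! hcon
  obtain ⟨t₂, ht₂, φ₂, hle⟩ := hcon
  obtain ⟨ψ₂, hψ₂, h₂⟩ := hred t₂ ht₂ φ₂
  set S : Set (ℝ × ℝ) := (Icc 0 b ×ˢ Icc 0 P) ∩ H ⁻¹' Iic m with hS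
  have hScomp : IsCompact S := by
    have hK : IsCompact ((Icc 0 b : Set ℝ) ×ˢ (Icc 0 P : Set ℝ)) :=
      isCompact_Icc.prod isCompact_Icc
    have hc := (hHc.mono (prod_mono_right (subset_univ _))).preimage_isClosed_of_isClosed
      (t := Iic m) hK.isClosed isClosed_Iic
    exact hK.of_isClosed_subset hc inter_subset_left
  have hSne : S.Nonempty := ⟨(t₂, ψ₂), ⟨ht₂, hψ₂⟩, by simpa [hH, ← h₂] using hle⟩
  obtain ⟨⟨t, φ⟩, ⟨⟨ht, hφ⟩, hm'⟩, hfirst⟩ :=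
    hScomp.exists_isMinOn hSne (f := Prod.fst) continuous_fst.continuousOn
  simp only [mem_preimage, mem_Iic] at hm' ht hφ
  have hbefore : ∀ s ∈ Ico 0 t, ∀ ψ, m < H (s, ψ) := by
    intro s hs ψ
    by_contra! hc
    have hsb : s ∈ Icc 0 b := ⟨hs.1, hs.2.le.trans ht.2⟩
    obtain ⟨ψ', hψ', h'⟩ := hred s hsb ψ
    have := hfirst (show (s, ψ') ∈ S from ⟨⟨hsb, hψ'⟩, by simpa [hH, ← h'] using hc⟩)
    exact absurd hs.2 (not_lt.2 this)
  have htpos : 0 < t := by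
    rcases ht.1.eq_or_lt with h | h
    · subst h
      exact absurd (hH0 φ) (not_lt.2 hm')
    · exact h
  have hle_all : ∀ ψ, m ≤ H (t, ψ) := by
    intro ψ
    have hcl : t ∈ closure (Ico 0 t) := by
      rw [closure_Ico htpos.ne]; exact ⟨htpos.le, le_rfl⟩
    have hcw : ContinuousWithinAt (fun s => H (s, ψ)) (Ico 0 t) t :=
      (hslice ψ t ht).mono fun s hs => ⟨hs.1, hs.2.le.trans ht.2⟩
    have := hcw.mem_closure_image hcl
    exact closure_minimal (t := Ici m)
      (by rintro _ ⟨s, hs, rfl⟩; exact (hbefore s hs ψ).le) isClosed_Ici this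
  have hHeq : H (t, φ) = m := le_antisymm hm' (hle_all φ)
  have hexp := Real.exp_pos (C * t)
  have hFpos : 0 < F t φ :=
    pos_of_mul_pos_right (hmpos.trans_eq hHeq.symm) hexp.le
  obtain ⟨F', hF', hlt⟩ := hmin t ⟨htpos, ht.2⟩ φ hFpos fun ψ =>
    le_of_mul_le_mul_left (hHeq.le.trans (hle_all ψ)) hexp
  have hd : HasDerivAt (fun s => H (s, φ))
      (Real.exp (C * t) * (C * 1) * F t φ + Real.exp (C * t) * F') t :=
    (((hasDerivAt_id t).const_mul C).exp).mul hF'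
  have hpos : 0 < Real.exp (C * t) * (C * 1) * F t φ + Real.exp (C * t) * F' := by
    have : 0 < Real.exp (C * t) * (C * F t φ + F') := mul_pos hexp (by linarith)
    linarith
  have hev : ∀ᶠ s in nhdsWithin t (Iio t), H (s, φ) < H (t, φ) := by
    have hs := (hasDerivAt_iff_tendsto_slope_left_right.1 hd).1.eventually (lt_mem_nhds hpos)
    filter_upwards [hs, self_mem_nhdsWithin] with s hs hst
    rw [slope_def_field] at hs
    by_contra! hc
    exact absurd hs (not_lt.2 (div_nonpos_of_nonneg_of_nonpos (sub_nonneg.2 hc)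
      (sub_nonpos.2 (le_of_lt hst))))
  have hev2 : ∀ᶠ s in nhdsWithin t (Iio t), s ∈ Ico 0 t := by
    filter_upwards [Ico_mem_nhdsLT htpos] with s hs using hs
  obtain ⟨s, hs1, hs2⟩ := (hev.and hev2).exists
  linarith [hbefore s hs2 φ]

section Complex

lemma hasDerivAt_complex_norm {a : ℝ → ℂ} {a' : ℂ} {x : ℝ} (ha : HasDerivAt a a' x)
    (h0 : a x ≠ 0) : HasDerivAt (fun s => ‖a s‖) (ip (a x) a' / ‖a x‖) x := by
  have h := ha.norm_sq.sqrt (pow_ne_zero 2 (norm_ne_zero_iff.2 h0))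
  simp only [Real.sqrt_sq (norm_nonneg _)] at h
  convert h using 1
  rw [Complex.inner, ip]
  simp
  ring

lemma hasDerivAt_re {a : ℝ → ℂ} {a' : ℂ} {x : ℝ} (ha : HasDerivAt a a' x) :
    HasDerivAt (fun s => (a s).re) a'.re x :=
  Complex.reCLM.hasFDerivAt.comp_hasDerivAt x ha

lemma hasDerivAt_im {a : ℝ → ℂ} {a' : ℂ} {x : ℝ} (ha : HasDerivAt a a' x) :
    HasDerivAt (fun s => (a s).im) a'.im x :=
  Complex.imCLM.hasFDerivAt.comp_hasDerivAt x ha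

lemma norm_sq_eq_re_im (a : ℂ) : ‖a‖ ^ 2 = a.re ^ 2 + a.im ^ 2 := by
  rw [Complex.sq_norm, Complex.normSq_apply]; ring

lemma nu_eq (z : ℝ → ℂ) (φ : ℝ) :
    nu z φ = (‖deriv z φ‖)⁻¹ • (-Complex.I * deriv z φ) := by
  rw [nu]
  congr 1
  apply Complex.ext <;> simp

end Complex

section Curve

variable {z : ℝ → ℂ}

/-- The Frenet equation for the unit normal. -/
lemma hasDerivAt_nu (hz : ContDiff ℝ (⊤ : ℕ∞) z) {φ : ℝ} (hreg : deriv z φ ≠ 0) :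
    HasDerivAt (nu z) (curv z φ • deriv z φ) φ := by
  have hd : HasDerivAt (deriv z) (deriv (deriv z) φ) φ :=
    ((hz.deriv' (n := (⊤ : ℕ∞))).differentiable (by simp) φ).hasDerivAt
  have hp : ‖deriv z φ‖ ≠ 0 := norm_ne_zero_iff.2 hreg
  have hsq := norm_sq_eq_re_im (deriv z φ)
  have h := ((hasDerivAt_complex_norm hd hreg).inv hp).smul (hd.const_mul (-Complex.I))
  have e : nu z = fun φ => (‖deriv z φ‖)⁻¹ • (-Complex.I * deriv z φ) := funext (nu_eq z)
  rw [e]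
  refine HasDerivAt.congr_deriv h ?_
  simp only [Pi.inv_apply]
  set p := ‖deriv z φ‖ with hp_def
  apply Complex.ext
  · simp only [curv, ip, Complex.smul_re, smul_eq_mul, Complex.add_re, Complex.mul_re,
      Complex.neg_re, Complex.neg_im, Complex.I_re, Complex.I_im]
    field_simp
    rw [← hp_def, hsq]
    ring
  · simp only [curv, ip, Complex.smul_im, smul_eq_mul, Complex.add_im, Complex.mul_im,
      Complex.neg_re, Complex.neg_im, Complex.I_re, Complex.I_im]
    field_simp
    rw [← hp_def, hsq]
    ring


lemma contDiff_nu (hz : ContDiff ℝ (⊤ : ℕ∞) z) (hreg : ∀ φ, deriv z φ ≠ 0) :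
    ContDiff ℝ (⊤ : ℕ∞) (nu z) := by
  have hd : ContDiff ℝ (⊤ : ℕ∞) (deriv z) := hz.deriv' (n := (⊤ : ℕ∞))
  rw [funext (nu_eq z)]
  exact ((hd.norm ℝ hreg).inv fun φ => norm_ne_zero_iff.2 (hreg φ)).smul
    (contDiff_const.mul hd)

lemma contDiff_curv (hz : ContDiff ℝ (⊤ : ℕ∞) z) (hreg : ∀ φ, deriv z φ ≠ 0) :
    ContDiff ℝ (⊤ : ℕ∞) (curv z) := by
  have hd : ContDiff ℝ (⊤ : ℕ∞) (deriv z) := hz.deriv' (n := (⊤ : ℕ∞))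
  have hdd : ContDiff ℝ (⊤ : ℕ∞) (deriv (deriv z)) := hd.deriv' (n := (⊤ : ℕ∞))
  have hre := Complex.reCLM.contDiff (n := (⊤ : ℕ∞))
  have him := Complex.imCLM.contDiff (n := (⊤ : ℕ∞))
  exact (((hre.comp hd).mul (him.comp hdd)).sub ((him.comp hd).mul (hre.comp hdd))).div
    ((hd.norm ℝ hreg).pow 3) fun φ => pow_ne_zero 3 (norm_ne_zero_iff.2 (hreg φ))

lemma contDiff_fq (n : ℕ) (hz : ContDiff ℝ (⊤ : ℕ∞) z) (hreg : ∀ φ, deriv z φ ≠ 0)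
    (hnz : ∀ φ, z φ ≠ 0) : ContDiff ℝ (⊤ : ℕ∞) (fq n z) := by
  have hre := Complex.reCLM.contDiff (n := (⊤ : ℕ∞))
  have him := Complex.imCLM.contDiff (n := (⊤ : ℕ∞))
  have hν := contDiff_nu hz hreg
  exact (contDiff_curv hz hreg).add ((contDiff_const.mul
    (((hre.comp hz).mul (hre.comp hν)).add ((him.comp hz).mul (him.comp hν)))).div
    ((hz.norm ℝ hnz).pow 2) fun φ => pow_ne_zero 2 (norm_ne_zero_iff.2 (hnz φ)))

/-- The first and second derivatives of the velocity field `-fν` of a curve, at a critical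
point of `f`. -/
lemma deriv_normal_velocity {f : ℝ → ℝ} (hf : ContDiff ℝ (⊤ : ℕ∞) f)
    (hz : ContDiff ℝ (⊤ : ℕ∞) z) (hreg : ∀ φ, deriv z φ ≠ 0) {φ : ℝ} (hcrit : deriv f φ = 0) :
    deriv (fun ψ => -(f ψ) • nu z ψ) φ = -(f φ * curv z φ) • deriv z φ ∧
    deriv (deriv (fun ψ => -(f ψ) • nu z ψ)) φ =
      -(deriv (deriv f) φ) • nu z φ -
        f φ • (deriv (curv z) φ • deriv z φ + curv z φ • deriv (deriv z) φ) := by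
  have hf1 : ∀ ψ, HasDerivAt f (deriv f ψ) ψ := fun ψ =>
    (hf.differentiable (by simp) ψ).hasDerivAt
  have hf2 : HasDerivAt (deriv f) (deriv (deriv f) φ) φ :=
    ((hf.deriv' (n := (⊤ : ℕ∞))).differentiable (by simp) φ).hasDerivAt
  have hz2 : HasDerivAt (deriv z) (deriv (deriv z) φ) φ :=
    ((hz.deriv' (n := (⊤ : ℕ∞))).differentiable (by simp) φ).hasDerivAt
  have hk : HasDerivAt (curv z) (deriv (curv z) φ) φ :=
    ((contDiff_curv hz hreg).differentiable (by simp) φ).hasDerivAt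
  have hW : deriv (fun ψ => -(f ψ) • nu z ψ) =
      fun ψ => -(f ψ) • (curv z ψ • deriv z ψ) + -(deriv f ψ) • nu z ψ :=
    funext fun ψ => ((hf1 ψ).neg.smul (hasDerivAt_nu hz (hreg ψ))).deriv
  refine ⟨?_, ?_⟩
  · rw [hW]
    simp [hcrit, mul_smul]
  · rw [hW]
    have h := (((hf1 φ).neg.smul (hk.smul hz2)).add
      (hf2.neg.smul (hasDerivAt_nu hz (hreg φ)))).deriv
    refine Eq.trans h ?_
    simp [hcrit]
    module

end Curve

/-- Time derivative of `f` at a point where the curve moves by the normal velocity `-fν` and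
`f` is spatially critical; `y`, `a`, `b` are the position and its first two spatial
derivatives. -/
lemma hasDerivAt_fq_of_critical {y a b : ℝ → ℂ} {t c f f₂ k k₁ : ℝ}
    (ha0 : a t ≠ 0) (hy0 : y t ≠ 0)
    (hk : k = ((a t).re * (b t).im - (a t).im * (b t).re) / ‖a t‖ ^ 3)
    (hy : HasDerivAt y (-f • ((‖a t‖)⁻¹ • (⟨(a t).im, -(a t).re⟩ : ℂ))) t)
    (ha : HasDerivAt a (-(f * k) • a t) t)
    (hb : HasDerivAt b (-f₂ • ((‖a t‖)⁻¹ • (⟨(a t).im, -(a t).re⟩ : ℂ)) -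
      f • (k₁ • a t + k • b t)) t) :
    HasDerivAt (fun s => ((a s).re * (b s).im - (a s).im * (b s).re) / ‖a s‖ ^ 3 +
        c * ip (y s) ((‖a s‖)⁻¹ • (⟨(a s).im, -(a s).re⟩ : ℂ)) / ‖y s‖ ^ 2)
      (f₂ / ‖a t‖ ^ 2 + f * (k ^ 2 + c * (2 * (ip (y t)
        ((‖a t‖)⁻¹ • (⟨(a t).im, -(a t).re⟩ : ℂ)) / ‖y t‖ ^ 2) ^ 2 - 1 / ‖y t‖ ^ 2))) t := by
  have hp : ‖a t‖ ≠ 0 := norm_ne_zero_iff.2 ha0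
  have hr : ‖y t‖ ≠ 0 := norm_ne_zero_iff.2 hy0
  have hpa := norm_sq_eq_re_im (a t)
  have hpn : HasDerivAt (fun s => ‖a s‖) (-(f * k) * ‖a t‖) t := by
    refine (hasDerivAt_complex_norm ha ha0).congr_deriv ?_
    rw [div_eq_iff hp]
    simp only [ip, Complex.smul_re, Complex.smul_im, smul_eq_mul]
    linear_combination (f * k) * hpa
  have hrn := hasDerivAt_complex_norm hy hy0
  have h1 := (((hasDerivAt_re ha).mul (hasDerivAt_im hb)).sub
    ((hasDerivAt_im ha).mul (hasDerivAt_re hb))).div (hpn.pow 3) (pow_ne_zero 3 hp)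
  have h2 := (((((hasDerivAt_re hy).mul ((hpn.inv hp).mul (hasDerivAt_im ha))).add
    ((hasDerivAt_im hy).mul ((hpn.inv hp).mul (hasDerivAt_re ha).neg))).const_mul c).div
    (hrn.pow 2) (pow_ne_zero 2 hr))
  have hdet : (a t).re * (b t).im - (a t).im * (b t).re = k * ‖a t‖ ^ 3 := by
    rw [hk]; field_simp
  have hfun : (fun s => ((a s).re * (b s).im - (a s).im * (b s).re) / ‖a s‖ ^ 3 +
        c * ip (y s) ((‖a s‖)⁻¹ • (⟨(a s).im, -(a s).re⟩ : ℂ)) / ‖y s‖ ^ 2) =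
      fun s => ((a s).re * (b s).im - (a s).im * (b s).re) / ‖a s‖ ^ 3 +
        c * ((y s).re * ((‖a s‖)⁻¹ * (a s).im) + (y s).im * ((‖a s‖)⁻¹ * -(a s).re)) /
          ‖y s‖ ^ 2 := by
    funext s; simp [ip]
  rw [hfun]
  refine (h1.add h2).congr_deriv ?_
  clear h1 h2 hfun hk
  simp only [ip, Complex.smul_re, Complex.smul_im, smul_eq_mul, Complex.sub_re, Complex.sub_im,
    Complex.add_re, Complex.add_im, Pi.inv_apply, Pi.mul_apply, Pi.sub_apply, Pi.add_apply,
    Pi.pow_apply, Pi.neg_apply]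
  set p := ‖a t‖
  set r := ‖y t‖
  rw [mul_add f (k ^ 2), ← add_assoc (f₂ / p ^ 2)]
  congr 1
  · push_cast
    field_simp
    linear_combination (-f₂) * hpa + f * k * p * hdet
  · push_cast
    field_simp
    ring_nf
    linear_combination c * f * r ^ 2 * hpa

lemma deriv_deriv_nonneg_of_forall_le {f : ℝ → ℝ} (hf : Continuous f) {x : ℝ}
    (hmin : ∀ y, f x ≤ f y) : 0 ≤ deriv (deriv f) x := by
  have hcrit : deriv f x = 0 := IsLocalMin.deriv_eq_zero (Filter.Eventually.of_forall hmin)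
  by_contra! hneg
  have hmax : IsLocalMax f x :=
    isLocalMax_of_deriv_deriv_neg hneg hcrit hf.continuousAt
  have hconst : f =ᶠ[nhds x] fun _ => f x := by
    filter_upwards [hmax] with y hy using le_antisymm hy (hmin y)
  rw [hconst.deriv.deriv_eq] at hneg
  simp at hneg

lemma fq_periodic (n : ℕ) {z : ℝ → ℂ} {P : ℝ} (hz : ∀ φ, z (φ + P) = z φ) (φ : ℝ) :
    fq n z (φ + P) = fq n z φ := by
  have h1 : ∀ {w : ℝ → ℂ}, (∀ φ, w (φ + P) = w φ) → ∀ φ, deriv w (φ + P) = deriv w φ := by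
    intro w hw φ
    rw [← deriv_comp_add_const w P φ, funext hw]
  simp only [fq, curv, nu, hz, h1 hz, h1 (h1 hz)]

/-- Tameness (f > 0) is preserved under the equivariant flow. -/
theorem tamed_preserved (n : ℕ) (hn : 1 ≤ n) (T : ℝ) (z : ℝ → ℝ → ℂ)
    (hsm : ContDiff ℝ (⊤ : ℕ∞) (fun p : ℝ × ℝ => z p.1 p.2))
    (hper : ∀ t φ, z t (φ + 2 * π) = z t φ)
    (hreg : ∀ t ∈ Ico (0:ℝ) T, ∀ φ, deriv (z t) φ ≠ 0)
    (hnz : ∀ t ∈ Ico (0:ℝ) T, ∀ φ, z t φ ≠ 0)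
    (hflow : ∀ t ∈ Ico (0:ℝ) T, ∀ φ,
      deriv (fun s => z s φ) t = -(fq n (z t) φ) • nu (z t) φ)
    (htamed : ∀ φ : ℝ, 0 < fq n (z 0) φ) :
    ∀ t ∈ Ico (0:ℝ) T, ∀ φ : ℝ, 0 < fq n (z t) φ := by
  intro t₁ ht₁ φ₁
  have hsub : Icc 0 t₁ ⊆ Ico 0 T := fun s hs => ⟨hs.1, hs.2.trans_lt ht₁.2⟩
  have hzφ := contDiff_deriv_snd hsm
  have hzφφ := contDiff_deriv_snd (G := fun t => deriv (z t)) hzφ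
  have hslice : ∀ t, ContDiff ℝ (⊤ : ℕ∞) (z t) := fun t =>
    hsm.comp (contDiff_const.prodMk contDiff_id)
  have hn' : (0 : ℝ) ≤ n - 1 := by
    have : (1 : ℝ) ≤ n := by exact_mod_cast hn
    linarith
  -- a uniform bound for `(n - 1) / |z|²`
  have hzcont : ContinuousOn (fun p : ℝ × ℝ => ((n : ℝ) - 1) / ‖z p.1 p.2‖ ^ 2)
      (Icc 0 t₁ ×ˢ Icc 0 (2 * π)) :=
    continuousOn_const.div (hsm.continuous.norm.pow 2).continuousOn fun p hp =>
      pow_ne_zero 2 (norm_ne_zero_iff.2 (hnz p.1 (hsub hp.1) p.2))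
  obtain ⟨C, hC⟩ := (isCompact_Icc.prod isCompact_Icc).bddAbove_image hzcont
  have hCall : ∀ t ∈ Icc 0 t₁, ∀ φ, ((n : ℝ) - 1) / ‖z t φ‖ ^ 2 ≤ C := by
    intro t ht φ
    obtain ⟨ψ, hψ, h⟩ :=
      Function.Periodic.exists_mem_Ico₀ (f := z t) (hper t) Real.two_pi_pos φ
    rw [h]
    exact hC ⟨(t, ψ), ⟨ht, Ico_subset_Icc_self hψ⟩, rfl⟩
  refine pos_of_decay_at_minima (F := fun t φ => fq n (z t) φ) (b := t₁) (C := C + 1)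
    Real.two_pi_pos ?_ (fun t _ φ => fq_periodic n (hper t) φ) htamed ?_ t₁
    ⟨ht₁.1, le_rfl⟩ φ₁
  · have hr : ∀ p ∈ Icc 0 t₁ ×ˢ (univ : Set ℝ), ‖z p.1 p.2‖ ≠ 0 := fun p hp =>
      norm_ne_zero_iff.2 (hnz p.1 (hsub hp.1) p.2)
    have hp : ∀ p ∈ Icc 0 t₁ ×ˢ (univ : Set ℝ), ‖deriv (z p.1) p.2‖ ≠ 0 := fun p hp =>
      norm_ne_zero_iff.2 (hreg p.1 (hsub hp.1) p.2)
    have c0 := hsm.continuous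
    have c1 := hzφ.continuous
    have c2 := hzφφ.continuous
    have hre := Complex.continuous_re
    have him := Complex.continuous_im
    have hcurv : ContinuousOn (fun p : ℝ × ℝ => curv (z p.1) p.2) (Icc 0 t₁ ×ˢ univ) :=
      ContinuousOn.div (((hre.comp c1).mul (him.comp c2)).sub
        ((him.comp c1).mul (hre.comp c2))).continuousOn
        (c1.norm.pow 3).continuousOn fun p h => pow_ne_zero 3 (hp p h)
    have hν : ContinuousOn (fun p : ℝ × ℝ => nu (z p.1) p.2) (Icc 0 t₁ ×ˢ univ) := by
      simp only [nu_eq]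
      exact (c1.norm.continuousOn.inv₀ hp).smul (continuous_const.mul c1).continuousOn
    exact hcurv.add (((continuousOn_const.mul
      (((hre.comp c0).continuousOn.mul (hre.comp_continuousOn hν)).add
        ((him.comp c0).continuousOn.mul (him.comp_continuousOn hν)))).div
      (c0.norm.pow 2).continuousOn) fun p h => pow_ne_zero 2 (hr p h))
  · intro t ht φ hpos hmin
    have htT := hsub ⟨ht.1.le, ht.2⟩
    have hf := contDiff_fq n (hslice t) (hreg t htT) (hnz t htT)
    have hcrit : deriv (fq n (z t)) φ = 0 :=
      IsLocalMin.deriv_eq_zero (Filter.Eventually.of_forall hmin)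
    have hf2 := deriv_deriv_nonneg_of_forall_le hf.continuous hmin
    obtain ⟨hW1, hW2⟩ := deriv_normal_velocity hf (hslice t) (hreg t htT) hcrit
    have hW : (fun ψ => deriv (fun s => z s ψ) t) =
        fun ψ => -(fq n (z t) ψ) • nu (z t) ψ := funext (hflow t htT)
    have hy := (hasDerivAt_fst_of_contDiff hsm t φ).differentiableAt.hasDerivAt
    rw [hflow t htT φ] at hy
    have ha : ∀ ψ, HasDerivAt (fun s => deriv (z s) ψ)
        (deriv (fun ψ => -(fq n (z t) ψ) • nu (z t) ψ) ψ) t := fun ψ =>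
      hW ▸ hasDerivAt_deriv_comm hsm t ψ
    have hb := hasDerivAt_deriv_comm (G := fun t => deriv (z t)) hzφ t φ
    rw [funext fun ψ => (ha ψ).deriv] at hb
    have ha := ha φ
    rw [hW1] at ha
    rw [hW2] at hb
    refine ⟨_, hasDerivAt_fq_of_critical (c := (n : ℝ) - 1)
      (k := curv (z t) φ) (hreg t htT φ)
      (hnz t htT φ) rfl hy ha hb, ?_⟩
    have hCt := hCall t ⟨ht.1.le, ht.2⟩ φ
    have h1 := div_nonneg hf2 (sq_nonneg ‖deriv (z t) φ‖)
    set h : ℝ := ip (z t φ) ((‖deriv (z t) φ‖)⁻¹ •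
      (⟨(deriv (z t) φ).im, -(deriv (z t) φ).re⟩ : ℂ)) / ‖z t φ‖ ^ 2
    have h2 : -(C + 1) < curv (z t) φ ^ 2 + ((n : ℝ) - 1) * (2 * h ^ 2 - 1 / ‖z t φ‖ ^ 2) := by
      have e1 := mul_nonneg hn' (sq_nonneg h)
      have e2 := sq_nonneg (curv (z t) φ)
      have e3 : ((n : ℝ) - 1) * (1 / ‖z t φ‖ ^ 2) ≤ C := by rwa [mul_one_div]
      linarith
    have h3 := mul_lt_mul_of_pos_left h2 hpos
    linarith
end

section
/- Let n ≥ 2 and let z : ℝ × [0,T) → ℂ \ {0} be a smooth solution of the equivariant flow (*), 2π-periodic and regular in φ for each t, such that z(·,t) is injective on [0,2π) for every t ∈ [0,T). If A(z(·,0)) > 0 and I(0) := ∫₀^{2π} (f √g)(φ,0) dφ > 0, then T ≤ A(z(·,0)) / I(0). -/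
open Real Set

open MeasureTheory Filter Topology

open scoped ContDiff Interval

section TwoParameter

lemma contDiff_fderiv_apply_const {w : ℝ × ℝ → ℂ} (hw : ContDiff ℝ ∞ w) (v : ℝ × ℝ) :
    ContDiff ℝ ∞ (fun p => fderiv ℝ w p v) :=
  (hw.fderiv_right (m := ∞) (by norm_cast)).clm_apply contDiff_const

lemma fderiv_fderiv_apply_comm {w : ℝ × ℝ → ℂ} (hw : ContDiff ℝ ∞ w) (p u v : ℝ × ℝ) :
    fderiv ℝ (fun q => fderiv ℝ w q u) p v = fderiv ℝ (fun q => fderiv ℝ w q v) p u := by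
  have hd : DifferentiableAt ℝ (fderiv ℝ w) p :=
    ((hw.fderiv_right (m := ∞) (by norm_cast)).differentiable (by simp)) p
  have h := hw.contDiffAt.isSymmSndFDerivAt (x := p) (by simpa using WithTop.coe_le_coe.2 (le_top : (2 : ℕ∞) ≤ ⊤))
  rw [fderiv_clm_apply hd (by fun_prop), fderiv_clm_apply hd (by fun_prop)]
  simpa using h v u

lemma fderiv_periodic {w : ℝ × ℝ → ℂ} {c : ℝ × ℝ} (hper : ∀ p, w (p + c) = w p) (p : ℝ × ℝ) :
    fderiv ℝ w (p + c) = fderiv ℝ w p := by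
  rw [← fderiv_comp_add_right]
  exact congrArg (fun f => fderiv ℝ f p) (funext hper)

/-- Green's theorem on a rectangle for the form `G dw`, periodic in the second variable. -/
lemma integral_loop_sub {w G : ℝ × ℝ → ℂ} {a b : ℝ} (hab : a ≤ b)
    (hw : ContDiff ℝ ∞ w) (hG : ∀ t ∈ Icc a b, ∀ φ, ContDiffAt ℝ ∞ G (t, φ))
    (hwper : ∀ t φ, w (t, φ + 2 * π) = w (t, φ)) (hGper : ∀ t φ, G (t, φ + 2 * π) = G (t, φ)) :
    (∫ φ in (0:ℝ)..(2 * π), G (b, φ) * fderiv ℝ w (b, φ) (0, 1)) -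
      ∫ φ in (0:ℝ)..(2 * π), G (a, φ) * fderiv ℝ w (a, φ) (0, 1) =
    ∫ t in a..b, ∫ φ in (0:ℝ)..(2 * π),
      (fderiv ℝ G (t, φ) (1, 0) * fderiv ℝ w (t, φ) (0, 1) -
        fderiv ℝ G (t, φ) (0, 1) * fderiv ℝ w (t, φ) (1, 0)) := by
  have hmem : ∀ p ∈ [[a, b]] ×ˢ [[0, 2 * π]], ContDiffAt ℝ ∞ G p := by
    rintro ⟨t, φ⟩ ⟨ht, -⟩
    exact hG t (by simpa [uIcc_of_le hab] using ht) φ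
  have hmem' : ∀ p ∈ Ioo (min a b) (max a b) ×ˢ Ioo (min 0 (2 * π)) (max 0 (2 * π)),
      ContDiffAt ℝ ∞ G p := fun p hp =>
    hmem p ⟨Ioo_subset_Icc_self hp.1, Ioo_subset_Icc_self hp.2⟩
  have hs := contDiff_fderiv_apply_const hw (0, 1)
  have ht := contDiff_fderiv_apply_const hw (1, 0)
  have hGd : ∀ p, ContDiffAt ℝ ∞ G p → ContDiffAt ℝ ∞ (fderiv ℝ G) p :=
    fun p hp => hp.fderiv_right (by norm_cast)
  have hGc : ContinuousOn G ([[a, b]] ×ˢ [[0, 2 * π]]) :=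
    fun p hp => (hmem p hp).continuousAt.continuousWithinAt
  have hGdc : ContinuousOn (fderiv ℝ G) ([[a, b]] ×ˢ [[0, 2 * π]]) :=
    fun p hp => (hGd p (hmem p hp)).continuousAt.continuousWithinAt
  have key : ∀ p : ℝ × ℝ,
      (G p • fderiv ℝ (fun q => fderiv ℝ w q (0, 1)) p +
        (fderiv ℝ w p (0, 1)) • fderiv ℝ G p) (1, 0) +
      (-(G p • fderiv ℝ (fun q => fderiv ℝ w q (1, 0)) p +
        (fderiv ℝ w p (1, 0)) • fderiv ℝ G p)) (0, 1) =
      fderiv ℝ G p (1, 0) * fderiv ℝ w p (0, 1) -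
        fderiv ℝ G p (0, 1) * fderiv ℝ w p (1, 0) := by
    intro p
    simp only [add_apply, smul_apply,
      neg_apply, smul_eq_mul, fderiv_fderiv_apply_comm hw p (0, 1) (1, 0)]
    ring
  have hGreen := integral2_divergence_prod_of_hasFDerivAt
    (fun p => G p * fderiv ℝ w p (0, 1)) (fun p => -(G p * fderiv ℝ w p (1, 0)))
    (fun p => G p • fderiv ℝ (fun q => fderiv ℝ w q (0, 1)) p +
        (fderiv ℝ w p (0, 1)) • fderiv ℝ G p)
    (fun p => -(G p • fderiv ℝ (fun q => fderiv ℝ w q (1, 0)) p +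
        (fderiv ℝ w p (1, 0)) • fderiv ℝ G p)) a 0 b (2 * π)
    (hGc.mul hs.continuous.continuousOn) (hGc.mul ht.continuous.continuousOn).neg
    (fun p hp => ((hmem' p hp).differentiableAt (by simp)).hasFDerivAt.mul
      (hs.differentiable (by simp) p).hasFDerivAt)
    (fun p hp => (((hmem' p hp).differentiableAt (by simp)).hasFDerivAt.mul
      (ht.differentiable (by simp) p).hasFDerivAt).neg)
    (by
      simp only [key]
      refine ContinuousOn.integrableOn_compact (isCompact_uIcc.prod isCompact_uIcc) ?_
      exact ((hGdc.clm_apply continuousOn_const).mul hs.continuous.continuousOn).sub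
        ((hGdc.clm_apply continuousOn_const).mul ht.continuous.continuousOn))
  simp only [key] at hGreen
  have hedge : ∀ t, G (t, 2 * π) * fderiv ℝ w (t, 2 * π) (1, 0) =
      G (t, 0) * fderiv ℝ w (t, 0) (1, 0) := by
    intro t
    have h1 := hGper t 0
    have h2 := fderiv_periodic (w := w) (c := (0, 2 * π))
      (fun p => by rw [← hwper p.1 p.2]; simp [Prod.add_def]) (t, 0)
    simp only [Prod.mk_add_mk, add_zero, zero_add] at h1 h2
    rw [h1, h2]
  rw [hGreen]
  simp only [hedge]
  ring

/-- The integral of the logarithmic derivative around a loop is invariant under homotopies through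
loops that avoid the origin. -/
lemma integral_logDeriv_loop_eq {w : ℝ × ℝ → ℂ} {a b : ℝ} (hab : a ≤ b) (hw : ContDiff ℝ ∞ w)
    (hper : ∀ t φ, w (t, φ + 2 * π) = w (t, φ)) (hne : ∀ t ∈ Icc a b, ∀ φ, w (t, φ) ≠ 0) :
    ∫ φ in (0:ℝ)..(2 * π), fderiv ℝ w (b, φ) (0, 1) / w (b, φ) =
      ∫ φ in (0:ℝ)..(2 * π), fderiv ℝ w (a, φ) (0, 1) / w (a, φ) := by
  have h := integral_loop_sub (w := w) (G := fun p => (w p)⁻¹) hab hw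
    (fun t ht φ => hw.contDiffAt.inv (hne t ht φ)) hper (fun t φ => by rw [hper])
  have hzero : ∀ t ∈ [[a, b]], ∫ φ in (0:ℝ)..(2 * π),
      (fderiv ℝ (fun p => (w p)⁻¹) (t, φ) (1, 0) * fderiv ℝ w (t, φ) (0, 1) -
        fderiv ℝ (fun p => (w p)⁻¹) (t, φ) (0, 1) * fderiv ℝ w (t, φ) (1, 0)) = 0 := by
    intro t ht
    rw [uIcc_of_le hab] at ht
    refine (intervalIntegral.integral_congr (g := fun _ => 0) fun φ _ => ?_).trans (by simp)
    have hinv := ((hasDerivAt_inv (hne t ht φ)).hasFDerivAt.restrictScalars ℝ |>.comp (t, φ)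
      (hw.differentiable (by simp) (t, φ)).hasFDerivAt).fderiv
    rw [show (fun p => (w p)⁻¹) = Inv.inv ∘ w from rfl]
    simp [hinv]
    ring
  rw [intervalIntegral.integral_congr (g := fun _ => 0) hzero] at h
  simp only [intervalIntegral.integral_zero, sub_eq_zero] at h
  simpa only [div_eq_inv_mul] using h

end TwoParameter

section Flow

variable {z : ℝ → ℝ → ℂ}

lemma deriv_eq_fderiv_uncurry_snd
    (hsm : ContDiff ℝ ∞ (fun p : ℝ × ℝ => z p.1 p.2)) (t φ : ℝ) :
    deriv (z t) φ = fderiv ℝ (fun p : ℝ × ℝ => z p.1 p.2) (t, φ) (0, 1) := by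
  have h := (hsm.differentiable (by simp) (t, φ)).hasFDerivAt.comp_hasDerivAt φ
    ((hasDerivAt_const φ t).prodMk (hasDerivAt_id φ))
  exact h.deriv

lemma deriv_eq_fderiv_uncurry_fst
    (hsm : ContDiff ℝ ∞ (fun p : ℝ × ℝ => z p.1 p.2)) (t φ : ℝ) :
    deriv (fun s => z s φ) t = fderiv ℝ (fun p : ℝ × ℝ => z p.1 p.2) (t, φ) (1, 0) := by
  have h := (hsm.differentiable (by simp) (t, φ)).hasFDerivAt.comp_hasDerivAt t
    ((hasDerivAt_id t).prodMk (hasDerivAt_const t φ))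
  exact h.deriv

lemma contDiff_uncurry_right (hsm : ContDiff ℝ ∞ (fun p : ℝ × ℝ => z p.1 p.2)) (t : ℝ) :
    ContDiff ℝ ∞ (z t) :=
  hsm.comp (contDiff_const.prodMk contDiff_id)

lemma contDiff_uncurry_deriv (hsm : ContDiff ℝ ∞ (fun p : ℝ × ℝ => z p.1 p.2)) :
    ContDiff ℝ ∞ (fun p : ℝ × ℝ => deriv (z p.1) p.2) := by
  simp only [deriv_eq_fderiv_uncurry_snd hsm]
  exact contDiff_fderiv_apply_const hsm (0, 1)

lemma deriv_add_of_periodic {γ : ℝ → ℂ} {c : ℝ} (hper : ∀ φ, γ (φ + c) = γ φ) (φ : ℝ) :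
    deriv γ (φ + c) = deriv γ φ := by
  rw [← deriv_comp_add_const]
  exact congrArg (fun f => deriv f φ) (funext hper)

lemma integral_im_eq {f : ℝ → ℂ} {a b : ℝ} (hf : Continuous f) :
    ∫ x in a..b, (f x).im = (∫ x in a..b, f x).im :=
  Complex.imCLM.intervalIntegral_comp_comm (hf.intervalIntegrable a b)

lemma integral_deriv_div_eq {a b : ℝ} (hab : a ≤ b)
    (hsm : ContDiff ℝ ∞ (fun p : ℝ × ℝ => z p.1 p.2))
    (hper : ∀ t φ, z t (φ + 2 * π) = z t φ) (hne : ∀ t ∈ Icc a b, ∀ φ, z t φ ≠ 0) :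
    ∫ φ in (0:ℝ)..(2 * π), deriv (z b) φ / z b φ =
      ∫ φ in (0:ℝ)..(2 * π), deriv (z a) φ / z a φ := by
  simpa only [deriv_eq_fderiv_uncurry_snd hsm] using integral_logDeriv_loop_eq hab hsm hper hne

lemma fq_mul_norm_deriv (n : ℕ) {γ : ℝ → ℂ} {φ : ℝ} (hne : γ φ ≠ 0) (hreg : deriv γ φ ≠ 0) :
    fq n γ φ * ‖deriv γ φ‖ =
      (deriv (deriv γ) φ / deriv γ φ).im + ((n : ℝ) - 1) * (deriv γ φ / γ φ).im := by
  have h1 : ‖deriv γ φ‖ ≠ 0 := norm_ne_zero_iff.2 hreg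
  have h2 : ‖γ φ‖ ≠ 0 := norm_ne_zero_iff.2 hne
  simp only [fq, curv, ip, nu, Complex.div_im, Complex.normSq_eq_norm_sq, Complex.smul_re,
    Complex.smul_im, smul_eq_mul]
  field_simp
  ring

lemma integral_fq_eq (n : ℕ) {γ : ℝ → ℂ} (hγ : ContDiff ℝ ∞ γ) (hne : ∀ φ, γ φ ≠ 0)
    (hreg : ∀ φ, deriv γ φ ≠ 0) :
    ∫ φ in (0:ℝ)..(2 * π), fq n γ φ * ‖deriv γ φ‖ =
      (∫ φ in (0:ℝ)..(2 * π), deriv (deriv γ) φ / deriv γ φ).im +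
        ((n : ℝ) - 1) * (∫ φ in (0:ℝ)..(2 * π), deriv γ φ / γ φ).im := by
  have hd : ContDiff ℝ ∞ (deriv γ) := (contDiff_infty_iff_deriv.1 hγ).2
  have c1 : Continuous (fun φ => deriv (deriv γ) φ / deriv γ φ) :=
    (contDiff_infty_iff_deriv.1 hd).2.continuous.div hd.continuous hreg
  have c2 : Continuous (fun φ => deriv γ φ / γ φ) := hd.continuous.div hγ.continuous hne
  have i1 : Continuous (fun φ => (deriv (deriv γ) φ / deriv γ φ).im) :=
    Complex.continuous_im.comp c1
  have i2 : Continuous (fun φ => (deriv γ φ / γ φ).im) := Complex.continuous_im.comp c2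
  simp only [fq_mul_norm_deriv n (hne _) (hreg _)]
  rw [intervalIntegral.integral_add
    (i1.intervalIntegrable _ _) ((i2.const_mul _).intervalIntegrable _ _),
    intervalIntegral.integral_const_mul, integral_im_eq c1, integral_im_eq c2]

/-- `∫ f √g dφ` is `2π` times (rotation index plus `n - 1` times winding number), hence constant
along a homotopy through regular loops that avoid the origin. -/
lemma integral_fq_const (n : ℕ) {a b : ℝ} (hab : a ≤ b)
    (hsm : ContDiff ℝ ∞ (fun p : ℝ × ℝ => z p.1 p.2))
    (hper : ∀ t φ, z t (φ + 2 * π) = z t φ)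
    (hreg : ∀ t ∈ Icc a b, ∀ φ, deriv (z t) φ ≠ 0) (hnz : ∀ t ∈ Icc a b, ∀ φ, z t φ ≠ 0) :
    ∫ φ in (0:ℝ)..(2 * π), fq n (z b) φ * ‖deriv (z b) φ‖ =
      ∫ φ in (0:ℝ)..(2 * π), fq n (z a) φ * ‖deriv (z a) φ‖ := by
  rw [integral_fq_eq n (contDiff_uncurry_right hsm b) (hnz b ⟨hab, le_rfl⟩) (hreg b ⟨hab, le_rfl⟩),
    integral_fq_eq n (contDiff_uncurry_right hsm a) (hnz a ⟨le_rfl, hab⟩) (hreg a ⟨le_rfl, hab⟩),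
    integral_deriv_div_eq hab hsm hper hnz,
    integral_deriv_div_eq (z := fun t => deriv (z t)) hab (contDiff_uncurry_deriv hsm)
      (fun t => deriv_add_of_periodic (hper t)) hreg]

/-- Along a normal motion with speed `-f`, the symplectic area decreases at rate `∫ f √g dφ`. -/
lemma integral_area_sub (n : ℕ) {b : ℝ} (hb : 0 ≤ b)
    (hsm : ContDiff ℝ ∞ (fun p : ℝ × ℝ => z p.1 p.2))
    (hper : ∀ t φ, z t (φ + 2 * π) = z t φ)
    (hreg : ∀ t ∈ Icc 0 b, ∀ φ, deriv (z t) φ ≠ 0) (hnz : ∀ t ∈ Icc 0 b, ∀ φ, z t φ ≠ 0)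
    (hflow : ∀ t ∈ Icc 0 b, ∀ φ,
      deriv (fun s => z s φ) t = -(fq n (z t) φ) • nu (z t) φ) :
    (∫ φ in (0:ℝ)..(2 * π), ((starRingEnd ℂ) (z b φ) * deriv (z b) φ).im) -
      ∫ φ in (0:ℝ)..(2 * π), ((starRingEnd ℂ) (z 0 φ) * deriv (z 0) φ).im =
    -2 * b * ∫ φ in (0:ℝ)..(2 * π), fq n (z 0) φ * ‖deriv (z 0) φ‖ := by
  have hcont : ∀ t, Continuous fun φ => (starRingEnd ℂ) (z t φ) * deriv (z t) φ := fun t =>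
    (Complex.continuous_conj.comp (contDiff_uncurry_right hsm t).continuous).mul
      (contDiff_infty_iff_deriv.1 (contDiff_uncurry_right hsm t)).2.continuous
  have hconj : ∀ p, fderiv ℝ (fun p : ℝ × ℝ => (starRingEnd ℂ) (z p.1 p.2)) p =
      (Complex.conjCLE : ℂ →L[ℝ] ℂ).comp (fderiv ℝ (fun p : ℝ × ℝ => z p.1 p.2) p) := fun p =>
    ((Complex.conjCLE : ℂ →L[ℝ] ℂ).hasFDerivAt.comp p
      (hsm.differentiable (by simp) p).hasFDerivAt).fderiv
  have h := integral_loop_sub (w := fun p : ℝ × ℝ => z p.1 p.2)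
    (G := fun p : ℝ × ℝ => (starRingEnd ℂ) (z p.1 p.2)) hb hsm
    (fun t _ φ => (Complex.conjCLE.contDiff.comp hsm).contDiffAt) hper
    (fun t φ => congrArg _ (hper t φ))
  simp only [hconj, ContinuousLinearMap.comp_apply, ← deriv_eq_fderiv_uncurry_snd hsm,
    ← deriv_eq_fderiv_uncurry_fst hsm] at h
  have hinner : ∀ t ∈ [[0, b]], ∫ φ in (0:ℝ)..(2 * π),
      ((Complex.conjCLE : ℂ →L[ℝ] ℂ) (deriv (fun s => z s φ) t) * deriv (z t) φ -
        (Complex.conjCLE : ℂ →L[ℝ] ℂ) (deriv (z t) φ) * deriv (fun s => z s φ) t) =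
      ((-2 * ∫ φ in (0:ℝ)..(2 * π), fq n (z 0) φ * ‖deriv (z 0) φ‖ : ℝ) : ℂ) * Complex.I := by
    intro t ht
    rw [uIcc_of_le hb] at ht
    rw [← integral_fq_const n ht.1 hsm hper (fun s hs => hreg s ⟨hs.1, hs.2.trans ht.2⟩)
      (fun s hs => hnz s ⟨hs.1, hs.2.trans ht.2⟩), ← intervalIntegral.integral_const_mul,
      ← intervalIntegral.integral_ofReal, ← intervalIntegral.integral_mul_const]
    refine intervalIntegral.integral_congr fun φ _ => ?_
    have h1 : ‖deriv (z t) φ‖ ≠ 0 := norm_ne_zero_iff.2 (hreg t ht φ)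
    have h2 : (deriv (z t) φ).re ^ 2 + (deriv (z t) φ).im ^ 2 = ‖deriv (z t) φ‖ ^ 2 := by
      rw [← Complex.normSq_eq_norm_sq, Complex.normSq_apply]; ring
    simp only [hflow t ht φ, nu]
    apply Complex.ext
    · simp
      ring
    · simp
      field_simp
      linear_combination (-2 * fq n (z t) φ) * h2
  rw [intervalIntegral.integral_congr hinner, intervalIntegral.integral_const] at h
  rw [integral_im_eq (hcont b), integral_im_eq (hcont 0), ← Complex.sub_im, h]
  simp
  ring

end Flow

section DiskPotential

lemma circleAverage_inv_sub_of_lt {z : ℂ} {r : ℝ} (hr : 0 ≤ r) (hrz : r < ‖z‖) :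
    circleAverage (fun p => (z - p)⁻¹) 0 r = z⁻¹ := by
  have hne : ∀ p ∈ Metric.closedBall (0:ℂ) |r|, z - p ≠ 0 := by
    intro p hp h0
    rw [mem_closedBall_zero_iff, abs_of_nonneg hr, ← sub_eq_zero.1 h0] at hp
    linarith
  have hd : DiffContOnCl ℂ (fun p => (z - p)⁻¹) (Metric.ball 0 |r|) := by
    refine DifferentiableOn.diffContOnCl fun p hp => DifferentiableAt.differentiableWithinAt ?_
    have := hne p (Metric.closure_ball_subset_closedBall hp)
    fun_prop (disch := assumption)
  simpa using hd.circleAverage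

lemma circleAverage_inv_sub_of_gt {z : ℂ} {r : ℝ} (hrz : ‖z‖ < r) :
    circleAverage (fun p => (z - p)⁻¹) 0 r = 0 := by
  have hr : 0 < r := (norm_nonneg z).trans_lt hrz
  have hne : ∀ p ∈ Metric.closedBall (0:ℂ) |r|, p * (starRingEnd ℂ) z - r ^ 2 ≠ 0 := by
    intro p hp h0
    rw [mem_closedBall_zero_iff, abs_of_pos hr] at hp
    have h1 := congrArg norm (sub_eq_zero.1 h0)
    rw [norm_mul, RCLike.norm_conj, norm_pow, Complex.norm_real, Real.norm_of_nonneg hr.le] at h1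
    nlinarith [norm_nonneg p, norm_nonneg z]
  have hd : DiffContOnCl ℂ (fun p => p / (p * (starRingEnd ℂ) z - r ^ 2)) (Metric.ball 0 |r|) := by
    refine DifferentiableOn.diffContOnCl fun p hp => DifferentiableAt.differentiableWithinAt ?_
    have := hne p (Metric.closure_ball_subset_closedBall hp)
    fun_prop (disch := assumption)
  have h0 := hd.circleAverage
  rw [zero_div, circleAverage_def, smul_eq_zero_iff_right (by positivity)] at h0
  have hconj : ∀ θ : ℝ, (z - circleMap 0 r θ)⁻¹ = (starRingEnd ℂ)
      (circleMap 0 r θ / (circleMap 0 r θ * (starRingEnd ℂ) z - r ^ 2)) := by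
    intro θ
    set p := circleMap 0 r θ with hp
    have hpn : ‖p‖ = r := by simp [hp, abs_of_pos hr]
    have hpp : p * (starRingEnd ℂ) p = r ^ 2 := by
      rw [Complex.mul_conj, Complex.normSq_eq_norm_sq, hpn]; push_cast; rfl
    have hp0 : (starRingEnd ℂ) p ≠ 0 := by
      rw [Ne, map_eq_zero, ← norm_eq_zero, hpn]; exact hr.ne'
    rw [map_div₀, map_sub, map_mul, Complex.conj_conj, map_pow, Complex.conj_ofReal, ← hpp,
      show (starRingEnd ℂ) p * z - p * (starRingEnd ℂ) p = (starRingEnd ℂ) p * (z - p) by ring,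
      div_mul_eq_div_div, div_self hp0, one_div]
  rw [circleAverage_def]
  simp only [hconj]
  rw [intervalIntegral.integral_of_le Real.two_pi_pos.le, integral_conj,
    ← intervalIntegral.integral_of_le Real.two_pi_pos.le, h0, map_zero, smul_zero]

lemma integrableOn_norm_inv_ball (R : ℝ) :
    IntegrableOn (fun q : ℂ => ‖q‖⁻¹) (Metric.ball 0 R) := by
  have h := (integrable_fun_norm_addHaar (volume : Measure ℂ)
    (f := (Iio R).indicator fun y : ℝ => y⁻¹)).2 (by
      rw [Complex.finrank_real_complex]
      have : IntegrableOn (fun _ : ℝ => (1:ℝ)) (Ioo 0 R) := by simp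
      have h2 : IntegrableOn ((Iio R).indicator fun _ : ℝ => (1:ℝ)) (Ioi 0) := by
        rw [integrableOn_indicator_iff measurableSet_Iio]
        exact this.mono_set (fun x hx => ⟨hx.2, hx.1⟩)
      refine h2.congr_fun (fun x hx => ?_) measurableSet_Ioi
      by_cases hxR : x ∈ Iio R
      · simp [hxR, (mem_Ioi.1 hx).ne']
      · simp [hxR])
  rw [← integrable_indicator_iff measurableSet_ball]
  refine h.congr (Eventually.of_forall fun q => ?_)
  by_cases hq : ‖q‖ < R <;> simp [indicator, hq]

lemma integrableOn_inv_sub_ball (z : ℂ) (R : ℝ) :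
    IntegrableOn (fun p : ℂ => (z - p)⁻¹) (Metric.ball 0 R) := by
  have h : IntegrableOn (fun q : ℂ => q⁻¹) (Metric.ball 0 (‖z‖ + R)) :=
    (integrable_norm_iff (by fun_prop)).1 (by simpa [IntegrableOn] using integrableOn_norm_inv_ball (‖z‖ + R))
  rw [← integrable_indicator_iff measurableSet_ball] at h
  have h2 := (h.comp_sub_left z).integrableOn (s := Metric.ball 0 R)
  refine h2.congr_fun (fun p hp => ?_) measurableSet_ball
  have : z - p ∈ Metric.ball (0:ℂ) (‖z‖ + R) := by
    rw [mem_ball_zero_iff] at hp ⊢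
    exact (norm_sub_le z p).trans_lt (by linarith)
  simp [this]

lemma integral_norm_inv_sub_ball_le (z : ℂ) (R : ℝ) :
    ∫ p in Metric.ball (0:ℂ) R, ‖(z - p)⁻¹‖ ≤
      ∫ q in Metric.ball (0:ℂ) (‖z‖ + R), ‖q‖⁻¹ := by
  rw [← integral_indicator measurableSet_ball, ← integral_indicator measurableSet_ball,
    ← integral_sub_left_eq_self (Set.indicator (Metric.ball (0:ℂ) (‖z‖ + R)) _) volume z]
  refine integral_mono_of_nonneg (Eventually.of_forall fun p => ?_) ?_
    (Eventually.of_forall fun p => ?_)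
  · exact indicator_nonneg (fun _ _ => norm_nonneg _) p
  · exact ((integrable_indicator_iff measurableSet_ball).2
      (integrableOn_norm_inv_ball _)).comp_sub_left z
  · by_cases hp : p ∈ Metric.ball (0:ℂ) R
    · have : z - p ∈ Metric.ball (0:ℂ) (‖z‖ + R) := by
        rw [mem_ball_zero_iff] at hp ⊢
        exact (norm_sub_le z p).trans_lt (by linarith)
      simp [hp, this]
    · simp only [indicator_of_notMem hp]
      exact indicator_nonneg (fun _ _ => by positivity) _

/-- The Cauchy transform of the indicator function of a disk. -/
lemma integral_inv_sub_ball {z : ℂ} {R : ℝ} (hz : ‖z‖ < R) :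
    ∫ p in Metric.ball (0:ℂ) R, (z - p)⁻¹ = π * (starRingEnd ℂ) z := by
  set f : ℂ → ℂ := (Metric.ball (0:ℂ) R).indicator fun p => (z - p)⁻¹ with hf
  have hfi : Integrable f :=
    (integrable_indicator_iff measurableSet_ball).2 (integrableOn_inv_sub_ball z R)
  have hfm : Measurable f := Measurable.indicator (by fun_prop) measurableSet_ball
  have hpolar : Integrable (fun q : ℝ × ℝ => q.1 • f (Complex.polarCoord.symm q))
      ((volume.restrict (Ioi (0:ℝ))).prod (volume.restrict (Ioo (-π) π))) := by
    rw [Measure.prod_restrict, ← Measure.volume_eq_prod]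
    have hc : Continuous fun q : ℝ × ℝ => Complex.polarCoord.symm q := by
      simp only [Complex.polarCoord_symm_apply]
      fun_prop
    refine ⟨(measurable_fst.smul (hfm.comp hc.measurable)).aestronglyMeasurable, ?_⟩
    have h2 := Complex.lintegral_comp_polarCoord_symm fun p => ‖f p‖ₑ
    rw [polarCoord_target] at h2
    refine lt_of_eq_of_lt ?_ (h2.trans_lt hfi.2)
    refine setLIntegral_congr_fun (measurableSet_Ioi.prod measurableSet_Ioo) fun q hq => ?_
    simp only [enorm_smul, smul_eq_mul, Real.enorm_of_nonneg (mem_Ioi.1 hq.1).le]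
  have hpolar_eq := Complex.integral_comp_polarCoord_symm f
  rw [polarCoord_target, Measure.volume_eq_prod, ← Measure.prod_restrict,
    integral_prod _ hpolar] at hpolar_eq
  rw [← integral_indicator measurableSet_ball, ← hf, ← hpolar_eq]
  have hcirc : ∀ r : ℝ, 0 < r → ∫ θ in Ioo (-π) π, r • f (Complex.polarCoord.symm (r, θ)) =
      (Iio R).indicator (fun r : ℝ => (2 * π * r : ℂ) * circleAverage (fun p => (z - p)⁻¹) 0 r) r := by
    intro r hr
    have hpt : ∀ θ : ℝ, Complex.polarCoord.symm (r, θ) = circleMap 0 r θ := fun θ => by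
      rw [Complex.polarCoord_symm_apply, circleMap_zero, Complex.exp_mul_I, Complex.ofReal_cos,
        Complex.ofReal_sin]
    simp only [hpt]
    by_cases hrR : r < R
    · have hball : ∀ θ, circleMap 0 r θ ∈ Metric.ball (0:ℂ) R := fun θ => by
        simpa [abs_of_pos hr] using hrR
      simp only [hf, indicator_of_mem (hball _), indicator_of_mem (mem_Iio.2 hrR)]
      rw [integral_smul, ← integral_Ioc_eq_integral_Ioo,
        ← intervalIntegral.integral_of_le (by linarith [Real.pi_pos]), circleAverage_def]
      have hper : Function.Periodic (fun θ => (z - circleMap 0 r θ)⁻¹) (2 * π) := fun θ => by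
        simp only [periodic_circleMap 0 r θ]
      have := hper.intervalIntegral_add_eq (-π) 0
      rw [show -π + 2 * π = π by ring, zero_add] at this
      rw [this, Complex.real_smul, Complex.real_smul]
      push_cast
      field_simp
    · have hball : ∀ θ, circleMap 0 r θ ∉ Metric.ball (0:ℂ) R := fun θ => by
        simpa [abs_of_pos hr] using hrR
      simp [hf, indicator_of_notMem (hball _), hrR]
  rw [setIntegral_congr_fun measurableSet_Ioi fun r hr => hcirc r hr,
    setIntegral_indicator measurableSet_Iio, Ioi_inter_Iio]
  have hae : ∀ᵐ r : ℝ, r ∈ Ioo 0 R →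
      (2 * π * r : ℂ) * circleAverage (fun p => (z - p)⁻¹) 0 r =
        (Ioc 0 ‖z‖).indicator (fun r : ℝ => (2 * π * z⁻¹ : ℂ) * r) r := by
    filter_upwards [Measure.ae_ne volume ‖z‖] with r hne hr
    rcases lt_or_gt_of_ne hne with hlt | hgt
    · rw [circleAverage_inv_sub_of_lt hr.1.le hlt, 
        indicator_of_mem (show r ∈ Ioc 0 ‖z‖ from ⟨hr.1, hlt.le⟩)]
      ring
    · rw [circleAverage_inv_sub_of_gt hgt, indicator_of_notMem (fun h => hgt.not_ge h.2), mul_zero]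
  rw [setIntegral_congr_ae measurableSet_Ioo hae, setIntegral_indicator measurableSet_Ioc,
    inter_eq_right.2 (show Ioc 0 ‖z‖ ⊆ Ioo 0 R from fun r hr => ⟨hr.1, hr.2.trans_lt hz⟩),
    ← intervalIntegral.integral_of_le (norm_nonneg z), intervalIntegral.integral_const_mul,
    intervalIntegral.integral_ofReal, integral_id]
  rcases eq_or_ne z 0 with rfl | hz0
  · simp
  · have : ((‖z‖ : ℝ) : ℂ) ^ 2 = (starRingEnd ℂ) z * z := by
      rw [mul_comm, Complex.mul_conj, Complex.normSq_eq_norm_sq]; push_cast; rfl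
    push_cast
    rw [this]
    field_simp
    ring

end DiskPotential

section Loop

/-- A smooth regular simple closed curve, parametrised with period `2π`. -/
structure IsSimpleLoop (γ : ℝ → ℂ) : Prop where
  contDiff : ContDiff ℝ ∞ γ
  periodic : ∀ φ, γ (φ + 2 * π) = γ φ
  deriv_ne_zero : ∀ φ, deriv γ φ ≠ 0
  injOn : InjOn γ (Ico 0 (2 * π))

/-- The Cauchy integral `∮ dζ / (ζ - p)` around the loop `γ`. -/
noncomputable def cauchyLoop (γ : ℝ → ℂ) (p : ℂ) : ℂ :=
  ∫ φ in (0:ℝ)..(2 * π), deriv γ φ / (γ φ - p)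

/-- The point at distance `s ‖γ' ψ‖` from `γ ψ` in the left normal direction. -/
noncomputable def normalPoint (γ : ℝ → ℂ) (ψ s : ℝ) : ℂ :=
  γ ψ + (s * Complex.I) * deriv γ ψ

namespace IsSimpleLoop

variable {γ : ℝ → ℂ}

lemma contDiff_deriv (h : IsSimpleLoop γ) : ContDiff ℝ ∞ (deriv γ) :=
  (contDiff_infty_iff_deriv.1 h.contDiff).2

lemma hasDerivAt (h : IsSimpleLoop γ) (φ : ℝ) : HasDerivAt γ (deriv γ φ) φ :=
  (h.contDiff.differentiable (by simp) φ).hasDerivAt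

lemma exists_mem_Ico (h : IsSimpleLoop γ) (φ : ℝ) : ∃ ψ ∈ Ico 0 (2 * π), γ φ = γ ψ :=
  Function.Periodic.exists_mem_Ico₀ h.periodic Real.two_pi_pos φ

lemma exists_eq_add (h : IsSimpleLoop γ) (φ ψ : ℝ) : ∃ t : ℝ, |t| ≤ π ∧ γ φ = γ (ψ + t) := by
  obtain ⟨y, hy, hyφ⟩ :=
    Function.Periodic.exists_mem_Ico h.periodic Real.two_pi_pos φ (ψ - π)
  refine ⟨y - ψ, abs_le.2 ⟨by linarith [hy.1], by linarith [hy.2]⟩, ?_⟩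
  rw [hyφ]
  congr 1
  ring

lemma eq_zero_of_apply_add_eq (h : IsSimpleLoop γ) {ψ t : ℝ} (ht : |t| ≤ π)
    (heq : γ (ψ + t) = γ ψ) : t = 0 := by
  have hmod : ∀ x, γ (toIcoMod Real.two_pi_pos 0 x) = γ x := fun x => by
    rw [toIcoMod]
    exact Function.Periodic.sub_zsmul_eq h.periodic _
  have hmem : ∀ x, toIcoMod Real.two_pi_pos 0 x ∈ Ico 0 (2 * π) := fun x => by
    simpa using toIcoMod_mem_Ico Real.two_pi_pos 0 x
  have h1 := h.injOn (hmem (ψ + t)) (hmem ψ) (by rw [hmod, hmod, heq])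
  obtain ⟨k, hk⟩ := (toIcoMod_eq_toIcoMod Real.two_pi_pos).1 h1
  rw [zsmul_eq_mul] at hk
  have hkt : t = -(k * (2 * π)) := by linarith
  have hk0 : k = 0 := by
    by_contra hk0
    have h2 : (1:ℝ) ≤ |(k:ℝ)| := by exact_mod_cast Int.one_le_abs hk0
    rw [hkt, abs_neg, abs_mul, abs_of_pos Real.two_pi_pos] at ht
    nlinarith [Real.pi_pos]
  simpa [hk0] using hkt

lemma exists_norm_le (h : IsSimpleLoop γ) :
    ∃ M : ℝ, 0 < M ∧ ∀ φ ∈ Icc (0:ℝ) (2 * π), ‖γ φ‖ ≤ M ∧ ‖deriv γ φ‖ ≤ M := by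
  obtain ⟨M₁, h₁⟩ := isCompact_Icc.exists_bound_of_continuousOn (s := Icc (0:ℝ) (2 * π))
    h.contDiff.continuous.continuousOn
  obtain ⟨M₂, h₂⟩ := isCompact_Icc.exists_bound_of_continuousOn (s := Icc (0:ℝ) (2 * π))
    h.contDiff_deriv.continuous.continuousOn
  refine ⟨max 1 (max M₁ M₂), by positivity, fun φ hφ => ⟨?_, ?_⟩⟩
  · exact (h₁ φ hφ).trans ((le_max_left _ _).trans (le_max_right _ _))
  · exact (h₂ φ hφ).trans ((le_max_right _ _).trans (le_max_right _ _))

lemma exists_norm_sub_le (h : IsSimpleLoop γ) :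
    ∃ δ > 0, ∀ ψ ∈ Icc (0:ℝ) (2 * π), ∀ t, |t| ≤ δ →
      ‖γ (ψ + t) - γ ψ - t * deriv γ ψ‖ ≤ ‖deriv γ ψ‖ / 4 * |t| := by
  obtain ⟨x₀, -, hx₀⟩ := isCompact_Icc.exists_isMinOn (s := Icc (0:ℝ) (2 * π))
    ⟨0, by simp [Real.pi_nonneg]⟩ h.contDiff_deriv.continuous.norm.continuousOn
  have hμ : 0 < ‖deriv γ x₀‖ := norm_pos_iff.2 (h.deriv_ne_zero x₀)
  have huc := (isCompact_Icc (a := (-1:ℝ)) (b := 2 * π + 1)).uniformContinuousOn_of_continuous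
    h.contDiff_deriv.continuous.continuousOn
  obtain ⟨δ, hδ, hδ'⟩ := Metric.uniformContinuousOn_iff.1 huc (‖deriv γ x₀‖ / 4) (by positivity)
  refine ⟨min 1 (δ / 2), by positivity, fun ψ hψ t ht => ?_⟩
  have ht1 : |t| ≤ 1 := ht.trans (min_le_left _ _)
  have htδ : |t| ≤ δ / 2 := ht.trans (min_le_right _ _)
  have hderiv : ∀ x, HasDerivAt (fun x : ℝ => γ (ψ + x) - x * deriv γ ψ)
      (deriv γ (ψ + x) - deriv γ ψ) x := fun x => by
    have h2 := ((hasDerivAt_id x).ofReal_comp).mul_const (deriv γ ψ)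
    simpa using ((h.hasDerivAt (ψ + x)).comp_const_add ψ x).fun_sub h2
  have hbound : ∀ x ∈ Icc (-|t|) |t|, ‖deriv γ (ψ + x) - deriv γ ψ‖ ≤ ‖deriv γ ψ‖ / 4 := by
    intro x hx
    have hx' : |x| ≤ |t| := abs_le.2 hx
    have hx1 := abs_le.1 (hx'.trans ht1)
    have := hδ' (ψ + x) ⟨by linarith [hψ.1, hx1.1], by linarith [hψ.2, hx1.2]⟩
      ψ ⟨by linarith [hψ.1], by linarith [hψ.2]⟩
      (by rw [Real.dist_eq, add_sub_cancel_left]; linarith)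
    rw [dist_eq_norm] at this
    have hmin : ‖deriv γ x₀‖ ≤ ‖deriv γ ψ‖ := hx₀ hψ
    linarith
  have := (convex_Icc (-|t|) |t|).norm_image_sub_le_of_norm_hasDerivWithin_le
    (fun x _ => (hderiv x).hasDerivWithinAt) hbound (x := 0) (y := t) (by simp)
    ⟨neg_abs_le t, le_abs_self t⟩
  simp only [add_zero, Complex.ofReal_zero, zero_mul, sub_zero, Real.norm_eq_abs] at this
  rwa [sub_right_comm] at this

lemma exists_le_norm_sub (h : IsSimpleLoop γ) {δ : ℝ} (hδ : 0 < δ) :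
    ∃ m > 0, ∀ ψ ∈ Icc (0:ℝ) (2 * π), ∀ t, δ ≤ |t| → |t| ≤ π → m ≤ ‖γ (ψ + t) - γ ψ‖ := by
  set K : Set (ℝ × ℝ) := (Icc (0:ℝ) (2 * π) ×ˢ Icc (-π) π) ∩ {q | δ ≤ |q.2|} with hK
  have hKc : IsCompact K := (isCompact_Icc.prod isCompact_Icc).inter_right
    (isClosed_le continuous_const continuous_snd.abs)
  have hmemK : ∀ ψ ∈ Icc (0:ℝ) (2 * π), ∀ t, δ ≤ |t| → |t| ≤ π → (ψ, t) ∈ K :=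
    fun ψ hψ t h1 h2 => ⟨⟨hψ, abs_le.1 h2⟩, h1⟩
  rcases K.eq_empty_or_nonempty with hE | hN
  · exact ⟨1, one_pos, fun ψ hψ t h1 h2 => by simpa [hE] using hmemK ψ hψ t h1 h2⟩
  have hc := h.contDiff.continuous
  obtain ⟨q, hq, hmin⟩ := hKc.exists_isMinOn hN
    (f := fun q : ℝ × ℝ => ‖γ (q.1 + q.2) - γ q.1‖) (by fun_prop)
  refine ⟨_, norm_pos_iff.2 (sub_ne_zero.2 fun heq => ?_),
    fun ψ hψ t h1 h2 => hmin (hmemK ψ hψ t h1 h2)⟩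
  have h0 := h.eq_zero_of_apply_add_eq (abs_le.2 hq.1.2) heq
  have := hq.2
  simp only [mem_ofPred_eq, h0, abs_zero] at this
  linarith

/-- Tubular neighbourhood: short normal segments meet the loop only at their base point. -/
lemma exists_normalPoint_ne (h : IsSimpleLoop γ) :
    ∃ ε > 0, ∀ ψ ∈ Icc (0:ℝ) (2 * π), ∀ s : ℝ, s ≠ 0 → |s| < ε → ∀ φ, γ φ ≠ normalPoint γ ψ s := by
  obtain ⟨δ, hδ, hnear⟩ := h.exists_norm_sub_le
  obtain ⟨m, hm, hfar⟩ := h.exists_le_norm_sub hδ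
  obtain ⟨M, hM, hbd⟩ := h.exists_norm_le
  refine ⟨m / M, by positivity, fun ψ hψ s hs hsε φ heq => ?_⟩
  obtain ⟨t, htπ, ht⟩ := h.exists_eq_add φ ψ
  have hpos : 0 < ‖deriv γ ψ‖ := norm_pos_iff.2 (h.deriv_ne_zero ψ)
  have hdiff : γ (ψ + t) - γ ψ = (s * Complex.I) * deriv γ ψ := by
    rw [← ht, heq, normalPoint]; ring
  rcases le_total |t| δ with hle | hle
  · have h1 := hnear ψ hψ t hle
    have h2 : γ (ψ + t) - γ ψ - t * deriv γ ψ = (s * Complex.I - t) * deriv γ ψ := by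
      rw [hdiff]; ring
    rw [h2, norm_mul] at h1
    have h3 := Complex.abs_re_le_norm (s * Complex.I - t)
    have h4 := Complex.abs_im_le_norm (s * Complex.I - t)
    simp at h3 h4
    have h5 : ‖(s * Complex.I - t : ℂ)‖ ≤ |t| / 4 := by
      by_contra! hcon
      nlinarith
    have h6 : |t| = 0 := by linarith [abs_nonneg t]
    have h7 : |s| = 0 := by linarith [abs_nonneg s]
    exact hs (abs_eq_zero.1 h7)
  · have h1 := hfar ψ hψ t hle htπ
    rw [hdiff, norm_mul] at h1
    simp only [norm_mul, Complex.norm_real, Complex.norm_I, mul_one, Real.norm_eq_abs] at h1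
    rw [lt_div_iff₀ hM] at hsε
    nlinarith [(hbd ψ hψ).2, abs_nonneg s]

lemma contDiff_normalPoint (h : IsSimpleLoop γ) {u σ : ℝ → ℝ} (hu : ContDiff ℝ ∞ u)
    (hσ : ContDiff ℝ ∞ σ) : ContDiff ℝ ∞ (fun t => normalPoint γ (u t) (σ t)) :=
  (h.contDiff.comp hu).add
    (((Complex.ofRealCLM.contDiff.comp hσ).mul contDiff_const).mul (h.contDiff_deriv.comp hu))

/-- `cauchyLoop γ` is constant along paths that avoid the loop. -/
lemma cauchyLoop_eq_of_path (h : IsSimpleLoop γ) {p : ℝ → ℂ} (hp : ContDiff ℝ ∞ p)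
    (hne : ∀ t ∈ Icc (0:ℝ) 1, ∀ φ, γ φ ≠ p t) : cauchyLoop γ (p 1) = cauchyLoop γ (p 0) := by
  have := integral_deriv_div_eq (z := fun t φ => γ φ - p t) zero_le_one
    ((h.contDiff.comp contDiff_snd).sub (hp.comp contDiff_fst))
    (fun t φ => by rw [h.periodic]) (fun t ht φ => sub_ne_zero.2 (hne t ht φ))
  simpa only [deriv_sub_const, cauchyLoop] using this

lemma cauchyLoop_normalPoint_eq (h : IsSimpleLoop γ) {ε : ℝ}
    (hε : ∀ ψ ∈ Icc (0:ℝ) (2 * π), ∀ s : ℝ, s ≠ 0 → |s| < ε → ∀ φ, γ φ ≠ normalPoint γ ψ s)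
    {ψ s s₀ : ℝ} (hψ : ψ ∈ Icc (0:ℝ) (2 * π)) (hss : 0 < s * s₀) (hs : |s| < ε) (hs₀ : |s₀| < ε) :
    cauchyLoop γ (normalPoint γ ψ s) = cauchyLoop γ (normalPoint γ 0 s₀) := by
  have := h.cauchyLoop_eq_of_path (p := fun t => normalPoint γ (t * ψ) (s₀ + t * (s - s₀)))
    (h.contDiff_normalPoint (by fun_prop) (by fun_prop))
    (fun t ht => ?_)
  · simpa using this
  · refine hε _ ⟨mul_nonneg ht.1 hψ.1, ?_⟩ _ ?_ ?_
    · exact (mul_le_of_le_one_left hψ.1 ht.2).trans hψ.2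
    · intro h0
      have hs0 : s₀ ≠ 0 := by rintro rfl; simp at hss
      have : (1 - t) * (s₀ * s₀) + t * (s * s₀) = 0 := by linear_combination s₀ * h0
      have hsq : 0 < s₀ * s₀ := mul_self_pos.2 hs0
      rcases eq_or_lt_of_le ht.2 with rfl | h1
      · linarith
      · nlinarith [mul_pos (sub_pos.2 h1) hsq, mul_nonneg ht.1 hss.le]
    · rw [show s₀ + t * (s - s₀) = (1 - t) * s₀ + t * s by ring]
      have hb := convex_ball (0:ℝ) ε
      have := hb (x := s₀) (by simpa using hs₀) (y := s) (by simpa using hs)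
        (sub_nonneg.2 ht.2) ht.1 (by ring)
      simpa using this

/-- Every point off the loop lies on a normal through its nearest point on the loop. -/
lemma exists_eq_normalPoint (h : IsSimpleLoop γ) {p : ℂ} (hp : ∀ φ, γ φ ≠ p) :
    ∃ ψ ∈ Icc (0:ℝ) (2 * π), ∃ s : ℝ, s ≠ 0 ∧ p = normalPoint γ ψ s ∧
      ∀ φ, ‖γ ψ - p‖ ≤ ‖γ φ - p‖ := by
  have hc := h.contDiff.continuous
  obtain ⟨ψ, hψ, hmin⟩ := isCompact_Icc.exists_isMinOn (s := Icc (0:ℝ) (2 * π))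
    ⟨0, by simp [Real.pi_nonneg]⟩ (f := fun φ => ‖γ φ - p‖) (by fun_prop)
  have hmin' : ∀ φ, ‖γ ψ - p‖ ≤ ‖γ φ - p‖ := fun φ => by
    obtain ⟨y, hy, hyφ⟩ := h.exists_mem_Ico φ
    rw [hyφ]
    exact hmin (Ico_subset_Icc_self hy)
  have hloc : IsLocalMin (fun φ => ‖γ φ - p‖ ^ 2) ψ :=
    Eventually.of_forall fun φ => pow_le_pow_left₀ (norm_nonneg _) (hmin' φ) 2
  have h0 := hloc.hasDerivAt_eq_zero ((h.hasDerivAt ψ).sub_const p).norm_sq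
  rw [Complex.inner] at h0
  set a := deriv γ ψ with ha
  have ha0 : a ≠ 0 := h.deriv_ne_zero ψ
  have hre : ((p - γ ψ) / a).re = 0 := by
    simp at h0
    rw [Complex.div_re, ← add_div, div_eq_zero_iff]
    left
    simp
    linarith
  have hp' : p = normalPoint γ ψ ((p - γ ψ) / a).im := by
    have h1 : (p - γ ψ) / a = ((p - γ ψ) / a).im * Complex.I := by
      apply Complex.ext <;> simp [hre]
    rw [normalPoint, ← h1, div_mul_cancel₀ _ ha0]
    ring
  refine ⟨ψ, hψ, _, fun hs => hp ψ ?_, hp', hmin'⟩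
  rw [hs] at hp'
  simpa [normalPoint] using hp'.symm

lemma cauchyLoop_eq_or (h : IsSimpleLoop γ) {ε s₀ : ℝ}
    (hε : ∀ ψ ∈ Icc (0:ℝ) (2 * π), ∀ s : ℝ, s ≠ 0 → |s| < ε → ∀ φ, γ φ ≠ normalPoint γ ψ s)
    (hs₀ : 0 < s₀) (hs₀ε : s₀ < ε) {p : ℂ} (hp : ∀ φ, γ φ ≠ p) :
    cauchyLoop γ p = cauchyLoop γ (normalPoint γ 0 s₀) ∨
      cauchyLoop γ p = cauchyLoop γ (normalPoint γ 0 (-s₀)) := by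
  obtain ⟨ψ, hψ, s, hs, rfl, hmin⟩ := h.exists_eq_normalPoint hp
  obtain ⟨r, hr0, hr1, hrε⟩ : ∃ r : ℝ, 0 < r ∧ r ≤ 1 ∧ |r * s| < ε := by
    have hspos := abs_pos.2 hs
    refine ⟨min 1 (s₀ / |s|), by positivity, min_le_left _ _, ?_⟩
    rw [abs_mul, abs_of_pos (by positivity)]
    calc min 1 (s₀ / |s|) * |s| ≤ s₀ / |s| * |s| := by gcongr; exact min_le_right _ _
      _ = s₀ := div_mul_cancel₀ _ hspos.ne'
      _ < ε := hs₀ε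
  have hpath := h.cauchyLoop_eq_of_path (p := fun t => normalPoint γ ψ ((r + t * (1 - r)) * s))
    (h.contDiff_normalPoint contDiff_const (by fun_prop))
    (fun t ht φ heq => by
      have hk0 : 0 < r + t * (1 - r) := by nlinarith [ht.1, ht.2]
      have hk1 : r + t * (1 - r) ≤ 1 := by nlinarith [ht.1, ht.2]
      have h1 := hmin φ
      rw [heq] at h1
      simp only [normalPoint] at h1
      rw [show γ ψ - (γ ψ + s * Complex.I * deriv γ ψ) = ((-s : ℝ) : ℂ) * (Complex.I * deriv γ ψ)
          by push_cast; ring,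
        show γ ψ + ((r + t * (1 - r)) * s : ℝ) * Complex.I * deriv γ ψ -
          (γ ψ + s * Complex.I * deriv γ ψ) =
          (((r + t * (1 - r) - 1) * s : ℝ) : ℂ) * (Complex.I * deriv γ ψ) by push_cast; ring,
        norm_mul, norm_mul _ (Complex.I * deriv γ ψ)] at h1
      have hpos : 0 < ‖Complex.I * deriv γ ψ‖ :=
        norm_pos_iff.2 (mul_ne_zero Complex.I_ne_zero (h.deriv_ne_zero ψ))
      have h2 := le_of_mul_le_mul_right h1 hpos
      rw [Complex.norm_real, Complex.norm_real, norm_mul, norm_neg] at h2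
      have h3 : 1 ≤ ‖r + t * (1 - r) - 1‖ := by
        have : 0 < ‖s‖ := norm_pos_iff.2 hs
        by_contra! hcon
        nlinarith
      rw [Real.norm_eq_abs, abs_of_nonpos (by linarith)] at h3
      linarith)
  simp only [one_mul, zero_mul, add_zero, add_sub_cancel] at hpath
  rw [hpath]
  rcases lt_or_gt_of_ne hs with hneg | hpos
  · right
    exact h.cauchyLoop_normalPoint_eq hε hψ (by nlinarith [mul_pos hr0 hs₀]) hrε
      (by rwa [abs_neg, abs_of_pos hs₀])
  · left
    exact h.cauchyLoop_normalPoint_eq hε hψ (by positivity) hrε (by rwa [abs_of_pos hs₀])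

lemma norm_cauchyLoop_le {M : ℝ}
    (hM : ∀ φ ∈ Icc (0:ℝ) (2 * π), ‖γ φ‖ ≤ M ∧ ‖deriv γ φ‖ ≤ M) {p : ℂ} (hp : M < ‖p‖) :
    ‖cauchyLoop γ p‖ ≤ 2 * π * M / (‖p‖ - M) := by
  have := intervalIntegral.norm_integral_le_of_norm_le_const (a := 0) (b := 2 * π)
    (f := fun φ => deriv γ φ / (γ φ - p)) (C := M / (‖p‖ - M)) (fun φ hφ => by
      rw [uIoc_of_le Real.two_pi_pos.le] at hφ
      have h1 := hM φ (Ioc_subset_Icc_self hφ)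
      have h2 := norm_sub_norm_le p (γ φ)
      rw [norm_div, norm_sub_rev (γ φ)]
      exact div_le_div₀ ((norm_nonneg _).trans h1.1) h1.2 (by linarith) (by linarith))
  rw [sub_zero, abs_of_pos Real.two_pi_pos] at this
  exact this.trans_eq (by ring)

lemma cauchyLoop_eq_zero_or (h : IsSimpleLoop γ) {ε s₀ : ℝ}
    (hε : ∀ ψ ∈ Icc (0:ℝ) (2 * π), ∀ s : ℝ, s ≠ 0 → |s| < ε → ∀ φ, γ φ ≠ normalPoint γ ψ s)
    (hs₀ : 0 < s₀) (hs₀ε : s₀ < ε) :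
    cauchyLoop γ (normalPoint γ 0 s₀) = 0 ∨ cauchyLoop γ (normalPoint γ 0 (-s₀)) = 0 := by
  by_contra! hne
  obtain ⟨M, hM0, hM⟩ := h.exists_norm_le
  obtain ⟨c, hc, hc1, hc2⟩ : ∃ c > 0, c < ‖cauchyLoop γ (normalPoint γ 0 s₀)‖ ∧
      c < ‖cauchyLoop γ (normalPoint γ 0 (-s₀))‖ := by
    obtain ⟨c, hc, hc'⟩ := exists_between
      (lt_min (norm_pos_iff.2 hne.1) (norm_pos_iff.2 hne.2))
    exact ⟨c, hc, hc'.trans_le (min_le_left _ _), hc'.trans_le (min_le_right _ _)⟩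
  set p : ℂ := ((M + 2 * π * M / c : ℝ) : ℂ) with hp
  have hpn : ‖p‖ = M + 2 * π * M / c := by
    rw [hp, Complex.norm_real, Real.norm_of_nonneg (by positivity)]
  have hpos : 0 < 2 * π * M / c := by positivity
  have hpM : M < ‖p‖ := by linarith
  have hoff : ∀ φ, γ φ ≠ p := fun φ heq => by
    obtain ⟨y, hy, hyφ⟩ := h.exists_mem_Ico φ
    have := (hM y (Ico_subset_Icc_self hy)).1
    rw [← hyφ, heq] at this
    linarith
  have hle := norm_cauchyLoop_le hM hpM
  rw [hpn, add_sub_cancel_left, div_div_cancel₀ (by positivity)] at hle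
  rcases h.cauchyLoop_eq_or hε hs₀ hs₀ε hoff with h1 | h1 <;> rw [h1] at hle <;> linarith

lemma volume_range (h : IsSimpleLoop γ) : volume (range γ) = 0 := by
  have h1 : dimH (range γ) ≤ 1 := by
    simpa using (h.contDiff.of_le (m := 1) (by simp)).dimH_range_le
  have h2 : (μH[(Module.finrank ℝ ℂ : ℝ)] : Measure ℂ) (range γ) = 0 := by
    have := hausdorffMeasure_of_dimH_lt (d := 2) (h1.trans_lt (by norm_num))
    simpa [Complex.finrank_real_complex] using this
  exact (Measure.absolutelyContinuous_isAddHaarMeasure volume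
    (μH[(Module.finrank ℝ ℂ : ℝ)] : Measure ℂ)) h2

lemma exists_le_norm_sq_add_sq (h : IsSimpleLoop γ) :
    ∃ κ > 0, ∃ s₁ > 0, ∀ s t : ℝ, 0 < s → s < s₁ → |t| ≤ π →
      κ * (t ^ 2 + s ^ 2) ≤ ‖(γ t - γ 0) ^ 2 + (s * deriv γ 0) ^ 2‖ := by
  obtain ⟨δ, hδ, hnear⟩ := h.exists_norm_sub_le
  obtain ⟨m, hm, hfar⟩ := h.exists_le_norm_sub hδ
  have h0mem : (0:ℝ) ∈ Icc (0:ℝ) (2 * π) := by simp [Real.pi_nonneg]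
  set a := deriv γ 0 with ha
  have ha0 : 0 < ‖a‖ := norm_pos_iff.2 (h.deriv_ne_zero 0)
  refine ⟨min (7 / 16 * ‖a‖ ^ 2) (m ^ 2 / 2 / (π ^ 2 + 1)), by positivity,
    min 1 (m / (2 * ‖a‖)), by positivity, fun s t hs hs₁ ht => ?_⟩
  rcases le_total |t| δ with hle | hle
  · have h1 := hnear 0 h0mem t hle
    rw [zero_add] at h1
    set e := γ t - γ 0 - t * a with he
    have h2 : (γ t - γ 0) ^ 2 + (s * a) ^ 2 =
        ((t ^ 2 + s ^ 2 : ℝ) : ℂ) * a ^ 2 - -(2 * (t * a) * e + e ^ 2) := by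
      rw [he]; push_cast; ring
    have h3 : ‖((t ^ 2 + s ^ 2 : ℝ) : ℂ) * a ^ 2‖ = (t ^ 2 + s ^ 2) * ‖a‖ ^ 2 := by
      rw [norm_mul, norm_pow, Complex.norm_real, Real.norm_of_nonneg (by positivity)]
    have h4 : ‖-(2 * (t * a) * e + e ^ 2)‖ ≤ 9 / 16 * (t ^ 2 * ‖a‖ ^ 2) := by
      rw [norm_neg]
      refine (norm_add_le _ _).trans ?_
      rw [norm_pow, norm_mul, norm_mul, norm_mul, Complex.norm_ofNat, Complex.norm_real,
        Real.norm_eq_abs, ← sq_abs t]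
      have h5 := mul_le_mul_of_nonneg_left h1 (show 0 ≤ 2 * (|t| * ‖a‖) by positivity)
      have h6 := pow_le_pow_left₀ (norm_nonneg e) h1 2
      calc 2 * (|t| * ‖a‖) * ‖e‖ + ‖e‖ ^ 2
          ≤ 2 * (|t| * ‖a‖) * (‖a‖ / 4 * |t|) + (‖a‖ / 4 * |t|) ^ 2 := add_le_add h5 h6
        _ = 9 / 16 * (|t| ^ 2 * ‖a‖ ^ 2) := by ring
    calc _ ≤ 7 / 16 * ‖a‖ ^ 2 * (t ^ 2 + s ^ 2) := by gcongr; exact min_le_left _ _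
      _ ≤ (t ^ 2 + s ^ 2) * ‖a‖ ^ 2 - 9 / 16 * (t ^ 2 * ‖a‖ ^ 2) := by
        nlinarith [mul_nonneg (sq_nonneg s) (sq_nonneg ‖a‖)]
      _ ≤ _ := by
        rw [h2]
        have := norm_sub_norm_le (((t ^ 2 + s ^ 2 : ℝ) : ℂ) * a ^ 2) (-(2 * (t * a) * e + e ^ 2))
        linarith
  · have h1 := hfar 0 h0mem t hle ht
    rw [zero_add] at h1
    have h2 : s * ‖a‖ ≤ m / 2 := by
      have := (lt_min_iff.1 hs₁).2
      rw [lt_div_iff₀ (by positivity)] at this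
      linarith
    have h3 : s ≤ 1 := (lt_min_iff.1 hs₁).1.le
    have h4 : ‖-(s * a) ^ 2‖ ≤ (m / 2) ^ 2 := by
      rw [norm_neg, norm_pow, norm_mul, Complex.norm_real, Real.norm_of_nonneg hs.le]
      exact pow_le_pow_left₀ (by positivity) h2 2
    have h5 : m ^ 2 ≤ ‖(γ t - γ 0) ^ 2‖ := by
      rw [norm_pow]
      exact pow_le_pow_left₀ hm.le h1 2
    have h6 := norm_sub_norm_le ((γ t - γ 0) ^ 2) (-(s * a) ^ 2)
    rw [sub_neg_eq_add] at h6
    calc _ ≤ m ^ 2 / 2 / (π ^ 2 + 1) * (π ^ 2 + 1) := by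
          have e1 : t ^ 2 ≤ π ^ 2 := sq_le_sq' (abs_le.1 ht).1 (abs_le.1 ht).2
          have e2 : s ^ 2 ≤ 1 := pow_le_one₀ hs.le h3
          exact mul_le_mul (min_le_right _ _) (add_le_add e1 e2) (by positivity) (by positivity)
      _ = m ^ 2 / 2 := div_mul_cancel₀ _ (by positivity)
      _ ≤ _ := by nlinarith

/-- The Cauchy integral jumps by `2πi` across the loop. -/
lemma tendsto_cauchyLoop_sub (h : IsSimpleLoop γ) :
    Tendsto (fun s => cauchyLoop γ (normalPoint γ 0 s) - cauchyLoop γ (normalPoint γ 0 (-s)))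
      (𝓝[>] 0) (𝓝 (2 * π * Complex.I)) := by
  obtain ⟨κ, hκ, s₁, hs₁, hlow⟩ := h.exists_le_norm_sq_add_sq
  obtain ⟨ε, hε, htube⟩ := h.exists_normalPoint_ne
  obtain ⟨M, hM0, hM⟩ := h.exists_norm_le
  have h0mem : (0:ℝ) ∈ Icc (0:ℝ) (2 * π) := by simp [Real.pi_nonneg]
  set a := deriv γ 0 with ha
  have ha0 : a ≠ 0 := h.deriv_ne_zero 0
  have hder : ∀ φ, ‖deriv γ φ‖ ≤ M := fun φ => by
    obtain ⟨y, hy, hyφ⟩ :=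
      Function.Periodic.exists_mem_Ico₀ (deriv_add_of_periodic h.periodic) Real.two_pi_pos φ
    rw [hyφ]
    exact (hM y (Ico_subset_Icc_self hy)).2
  set G : ℝ → ℝ → ℂ := fun s x =>
    deriv γ (s * x) * (2 * Complex.I * a) * (s ^ 2 / ((γ (s * x) - γ 0) ^ 2 + (s * a) ^ 2)) with hG
  have hsmall : ∀ᶠ s : ℝ in 𝓝[>] 0, 0 < s ∧ s < s₁ ∧ s < ε := by
    filter_upwards [Ioo_mem_nhdsGT (lt_min hs₁ hε)] with s hs
    exact ⟨hs.1, hs.2.trans_le (min_le_left _ _), hs.2.trans_le (min_le_right _ _)⟩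
  have hrepr : ∀ᶠ s : ℝ in 𝓝[>] 0,
      ∫ x, (Ioc (-π / s) (π / s)).indicator (G s) x =
        cauchyLoop γ (normalPoint γ 0 s) - cauchyLoop γ (normalPoint γ 0 (-s)) := by
    filter_upwards [hsmall] with s hs'
    obtain ⟨hs, -, hsε⟩ := hs'
    have hne1 : ∀ φ, γ φ - normalPoint γ 0 s ≠ 0 := fun φ =>
      sub_ne_zero.2 (htube 0 h0mem s hs.ne' (by rwa [abs_of_pos hs]) φ)
    have hne2 : ∀ φ, γ φ - normalPoint γ 0 (-s) ≠ 0 := fun φ =>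
      sub_ne_zero.2 (htube 0 h0mem (-s) (neg_ne_zero.2 hs.ne') (by rwa [abs_neg, abs_of_pos hs]) φ)
    have hc := h.contDiff.continuous
    have hc' := h.contDiff_deriv.continuous
    have hintegrable : ∀ p : ℂ, (∀ φ, γ φ - p ≠ 0) →
        IntervalIntegrable (fun φ => deriv γ φ / (γ φ - p)) volume 0 (2 * π) := fun p hp =>
      (hc'.div (hc.sub continuous_const) hp).intervalIntegrable _ _
    have hle : -π / s ≤ π / s := by gcongr; linarith [Real.pi_pos]
    rw [integral_indicator measurableSet_Ioc, ← intervalIntegral.integral_of_le hle,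
      cauchyLoop, cauchyLoop, ← intervalIntegral.integral_sub (hintegrable _ hne1) (hintegrable _ hne2)]
    set F : ℝ → ℂ := fun φ => deriv γ φ / (γ φ - normalPoint γ 0 s) -
      deriv γ φ / (γ φ - normalPoint γ 0 (-s)) with hF
    have hper : Function.Periodic F (2 * π) := fun φ => by
      simp only [hF, h.periodic, deriv_add_of_periodic h.periodic]
    have hshift := hper.intervalIntegral_add_eq (-π) 0
    rw [show -π + 2 * π = π by ring, zero_add] at hshift
    rw [← hshift]
    have hGF : ∀ x, G s x = s • F (s * x) := fun x => by
      have e1 := hne1 (s * x)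
      have e2 := hne2 (s * x)
      simp only [normalPoint, ← ha] at e1 e2
      simp only [hG, hF, normalPoint, ← ha, Complex.real_smul]
      have e3 : (γ (s * x) - γ 0) ^ 2 + (s * a) ^ 2 =
          (γ (s * x) - (γ 0 + s * Complex.I * a)) *
            (γ (s * x) - (γ 0 + ((-s : ℝ) : ℂ) * Complex.I * a)) := by
        push_cast
        linear_combination ((s * a) ^ 2) * Complex.I_sq
      rw [e3, div_sub_div _ _ e1 e2, mul_div_assoc', mul_div_assoc']
      congr 1
      push_cast
      ring
    simp only [hGF]
    rw [intervalIntegral.integral_smul, intervalIntegral.smul_integral_comp_mul_left,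
      mul_div_cancel₀ _ hs.ne', mul_div_cancel₀ _ hs.ne']
  have hlim : ∫ x : ℝ, 2 * Complex.I * (((1 + x ^ 2)⁻¹ : ℝ) : ℂ) = 2 * π * Complex.I := by
    rw [integral_const_mul, integral_complex_ofReal, integral_univ_inv_one_add_sq]
    ring
  rw [← hlim]
  refine Tendsto.congr' hrepr ?_
  refine tendsto_integral_filter_of_dominated_convergence
    (fun x => (M * (2 * ‖a‖) / κ) * (1 + x ^ 2)⁻¹) ?_ ?_
    (integrable_inv_one_add_sq.const_mul _) ?_
  · refine Eventually.of_forall fun s => ?_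
    have hc := h.contDiff.continuous
    have hc' := h.contDiff_deriv.continuous
    have : Measurable (G s) := by
      have e1 : Measurable fun x => γ (s * x) := (hc.comp (continuous_const_mul s)).measurable
      have e2 : Measurable fun x => deriv γ (s * x) :=
        (hc'.comp (continuous_const_mul s)).measurable
      fun_prop
    exact (this.indicator measurableSet_Ioc).aestronglyMeasurable
  · filter_upwards [hsmall] with s hs'
    obtain ⟨hs, hss₁, -⟩ := hs'
    refine Eventually.of_forall fun x => ?_
    by_cases hx : x ∈ Ioc (-π / s) (π / s)
    · rw [indicator_of_mem hx]
      have hsx : |s * x| ≤ π := by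
        rw [abs_le]
        constructor
        · have := hx.1
          rw [div_lt_iff₀ hs] at this
          linarith
        · have := hx.2
          rw [le_div_iff₀ hs] at this
          linarith
      have hl := hlow s (s * x) hs hss₁ hsx
      simp only [hG]
      have e : κ * ((s * x) ^ 2 + s ^ 2) = κ * (s ^ 2 * (1 + x ^ 2)) := by ring
      rw [e] at hl
      rw [norm_mul, norm_mul, norm_mul, norm_mul, norm_div, Complex.norm_I, Complex.norm_ofNat,
        norm_pow, Complex.norm_real, Real.norm_of_nonneg hs.le, mul_one]
      calc _ ≤ M * (2 * ‖a‖) * (s ^ 2 / (κ * (s ^ 2 * (1 + x ^ 2)))) := by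
            gcongr
            exact hder _
        _ = _ := by field_simp
    · rw [indicator_of_notMem hx, norm_zero]
      positivity
  · refine Eventually.of_forall fun x => ?_
    have hin : ∀ᶠ s : ℝ in 𝓝[>] 0, x ∈ Ioc (-π / s) (π / s) := by
      filter_upwards [Ioo_mem_nhdsGT (show 0 < π / (|x| + 1) by positivity)] with s hs
      have h1 := hs.2
      rw [lt_div_iff₀ (by positivity)] at h1
      have h2 := mul_le_mul_of_nonneg_left (le_abs_self x) hs.1.le
      have h3 := mul_le_mul_of_nonneg_left (neg_abs_le x) hs.1.le
      have := hs.1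
      constructor
      · rw [div_lt_iff₀ hs.1]; nlinarith
      · rw [le_div_iff₀ hs.1]; nlinarith
    have hsx : Tendsto (fun s : ℝ => s * x) (𝓝[>] 0) (𝓝 0) := by
      have : Tendsto (fun s : ℝ => s * x) (𝓝 0) (𝓝 (0 * x)) := tendsto_id.mul_const x
      rw [zero_mul] at this
      exact this.mono_left nhdsWithin_le_nhds
    have hslope : Tendsto (fun s : ℝ => s⁻¹ • (γ (s * x) - γ 0)) (𝓝[>] 0) (𝓝 (x * a)) := by
      have hd : HasDerivAt (fun s : ℝ => γ (s * x)) (x • a) 0 := by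
        have h1 : HasDerivAt γ a (0 * x) := by rw [zero_mul]; exact h.hasDerivAt 0
        simpa [Function.comp_def] using h1.scomp 0 ((hasDerivAt_id (0:ℝ)).mul_const x)
      have := hd.tendsto_slope_zero_right
      simpa [Complex.real_smul] using this
    have hden : (x * a) ^ 2 + a ^ 2 ≠ 0 := by
      have : (1 + x ^ 2 : ℂ) ≠ 0 := by
        have : (1 + x ^ 2 : ℝ) ≠ 0 := by positivity
        exact_mod_cast this
      rw [show (x * a) ^ 2 + a ^ 2 = (1 + x ^ 2 : ℂ) * a ^ 2 by ring]
      exact mul_ne_zero this (pow_ne_zero 2 ha0)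
    have hlimit : Tendsto (fun s : ℝ => deriv γ (s * x) * (2 * Complex.I * a) /
        ((s⁻¹ • (γ (s * x) - γ 0)) ^ 2 + a ^ 2)) (𝓝[>] 0)
        (𝓝 (a * (2 * Complex.I * a) / ((x * a) ^ 2 + a ^ 2))) :=
      (((h.contDiff_deriv.continuous.tendsto 0).comp hsx).mul_const _).div
        ((hslope.pow 2).add_const _) hden
    have hval : a * (2 * Complex.I * a) / ((x * a) ^ 2 + a ^ 2) =
        2 * Complex.I * (((1 + x ^ 2)⁻¹ : ℝ) : ℂ) := by
      push_cast
      rw [show (x * a) ^ 2 + a ^ 2 = (1 + x ^ 2 : ℂ) * a ^ 2 by ring]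
      field_simp
    rw [hval] at hlimit
    refine hlimit.congr' ?_
    filter_upwards [hin, self_mem_nhdsWithin] with s hs hs0
    have hs0' : (s : ℂ) ≠ 0 := Complex.ofReal_ne_zero.2 (mem_Ioi.1 hs0).ne'
    rw [indicator_of_mem hs]
    simp only [hG]
    rw [div_eq_mul_inv, Complex.real_smul, Complex.ofReal_inv,
      show ((s : ℂ)⁻¹ * (γ (s * x) - γ 0)) ^ 2 + a ^ 2 =
        ((γ (s * x) - γ 0) ^ 2 + (s * a) ^ 2) / s ^ 2 by field_simp, inv_div]

lemma cauchyLoop_sub_eq (h : IsSimpleLoop γ) {ε s₀ : ℝ}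
    (hε : ∀ ψ ∈ Icc (0:ℝ) (2 * π), ∀ s : ℝ, s ≠ 0 → |s| < ε → ∀ φ, γ φ ≠ normalPoint γ ψ s)
    (hs₀ : 0 < s₀) (hs₀ε : s₀ < ε) :
    cauchyLoop γ (normalPoint γ 0 s₀) - cauchyLoop γ (normalPoint γ 0 (-s₀)) =
      2 * π * Complex.I := by
  have h0mem : (0:ℝ) ∈ Icc (0:ℝ) (2 * π) := by simp [Real.pi_nonneg]
  have habs : |s₀| < ε := by rwa [abs_of_pos hs₀]
  refine tendsto_nhds_unique (tendsto_const_nhds.congr' ?_) h.tendsto_cauchyLoop_sub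
  filter_upwards [Ioo_mem_nhdsGT (hs₀.trans hs₀ε)] with s hs
  have habs' : |s| < ε := by rw [abs_of_pos hs.1]; exact hs.2
  rw [h.cauchyLoop_normalPoint_eq hε h0mem (mul_pos hs.1 hs₀) habs' habs,
    h.cauchyLoop_normalPoint_eq hε h0mem (s := -s) (s₀ := -s₀) (by nlinarith [mul_pos hs.1 hs₀])
      (by rwa [abs_neg]) (by rwa [abs_neg])]

lemma integrable_kernel_prod (h : IsSimpleLoop γ) (R : ℝ) :
    Integrable (fun q : ℝ × ℂ => deriv γ q.1 / (γ q.1 - q.2))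
      ((volume.restrict (uIoc 0 (2 * π))).prod (volume.restrict (Metric.ball 0 R))) := by
  obtain ⟨M, hM0, hM⟩ := h.exists_norm_le
  have hc := h.contDiff.continuous.measurable
  have hc' := h.contDiff_deriv.continuous.measurable
  have hmeas : Measurable fun q : ℝ × ℂ => deriv γ q.1 / (γ q.1 - q.2) := by fun_prop
  refine (integrable_prod_iff hmeas.aestronglyMeasurable).2
    ⟨Eventually.of_forall fun φ => ?_, ?_⟩
  · simp only [div_eq_mul_inv]
    exact (integrableOn_inv_sub_ball (γ φ) R).const_mul (deriv γ φ)
  · refine Measure.integrableOn_of_bounded (M := M * ∫ q in Metric.ball (0:ℂ) (M + R), ‖q‖⁻¹)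
      (by simp [uIoc]) ?_ ?_
    · exact (hmeas.aestronglyMeasurable.norm.integral_prod_right' (μ := volume)
        (ν := volume.restrict (Metric.ball (0:ℂ) R)))
    · refine (ae_restrict_iff' measurableSet_uIoc).2 (Eventually.of_forall fun φ hφ => ?_)
      rw [uIoc_of_le Real.two_pi_pos.le] at hφ
      have hb := hM φ (Ioc_subset_Icc_self hφ)
      rw [Real.norm_of_nonneg (integral_nonneg fun _ => norm_nonneg _)]
      simp only [div_eq_mul_inv, norm_mul]
      rw [integral_const_mul]
      refine mul_le_mul hb.2 ((integral_norm_inv_sub_ball_le _ R).trans ?_)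
        (integral_nonneg fun _ => norm_nonneg _) hM0.le
      refine setIntegral_mono_set (integrableOn_norm_inv_ball _)
        (Eventually.of_forall fun q => by positivity) ?_
      exact (Metric.ball_subset_ball (by linarith [hb.1])).eventuallyLE

lemma integrableOn_cauchyLoop (h : IsSimpleLoop γ) (R : ℝ) :
    IntegrableOn (cauchyLoop γ) (Metric.ball 0 R) := by
  have := (h.integrable_kernel_prod R).integral_prod_right
  simpa only [IntegrableOn, funext_iff.2 fun p => cauchyLoop.eq_1 γ p,
    intervalIntegral.integral_of_le Real.two_pi_pos.le, uIoc_of_le Real.two_pi_pos.le] using this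

lemma integral_cauchyLoop (h : IsSimpleLoop γ) {R : ℝ} (hR : ∀ φ, ‖γ φ‖ < R) :
    ∫ p in Metric.ball 0 R, cauchyLoop γ p =
      π * ∫ φ in (0:ℝ)..(2 * π), (starRingEnd ℂ) (γ φ) * deriv γ φ := by
  simp only [cauchyLoop]
  rw [← intervalIntegral_integral_swap (h.integrable_kernel_prod R),
    ← intervalIntegral.integral_const_mul]
  refine intervalIntegral.integral_congr fun φ _ => ?_
  simp only [div_eq_mul_inv]
  rw [integral_const_mul, integral_inv_sub_ball (hR φ)]
  ring

lemma isClosed_range (h : IsSimpleLoop γ) : IsClosed (range γ) := by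
  have : range γ = γ '' Icc 0 (2 * π) := by
    refine (range_subset_iff.2 fun φ => ?_).antisymm (image_subset_range _ _)
    obtain ⟨y, hy, hyφ⟩ := h.exists_mem_Ico φ
    exact ⟨y, Ico_subset_Icc_self hy, hyφ.symm⟩
  rw [this]
  exact (isCompact_Icc.image h.contDiff.continuous).isClosed

lemma eventually_cauchyLoop_eq (h : IsSimpleLoop γ) {q : ℂ} (hq : ∀ φ, γ φ ≠ q) :
    ∀ᶠ p in 𝓝 q, cauchyLoop γ p = cauchyLoop γ q := by
  have hmem : (range γ)ᶜ ∈ 𝓝 q :=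
    h.isClosed_range.isOpen_compl.mem_nhds fun ⟨φ, hφ⟩ => hq φ hφ
  obtain ⟨r, hr, hball⟩ := Metric.mem_nhds_iff.1 hmem
  filter_upwards [Metric.ball_mem_nhds q hr] with p hp
  have := h.cauchyLoop_eq_of_path (p := fun t => q + t * (p - q))
    (contDiff_const.add (Complex.ofRealCLM.contDiff.mul contDiff_const)) (fun t ht φ heq => by
      refine hball ?_ ⟨φ, heq⟩
      rw [Metric.mem_ball, dist_eq_norm] at hp ⊢
      rw [add_sub_cancel_left, norm_mul, Complex.norm_real, Real.norm_of_nonneg ht.1]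
      exact (mul_le_of_le_one_left (norm_nonneg _) ht.2).trans_lt hp)
  simpa using this

/-- A Cauchy integral that only takes the values `0` and `c`, with `Im c ≠ 0`, forces the loop to
enclose non-zero area. -/
lemma integral_area_ne_zero_of_cauchyLoop (h : IsSimpleLoop γ) {c q : ℂ} (hc : c.im ≠ 0)
    (hval : ∀ p, (∀ φ, γ φ ≠ p) → cauchyLoop γ p = 0 ∨ cauchyLoop γ p = c)
    (hq : ∀ φ, γ φ ≠ q) (hqc : cauchyLoop γ q = c) :
    (∫ φ in (0:ℝ)..(2 * π), (starRingEnd ℂ) (γ φ) * deriv γ φ).im ≠ 0 := by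
  intro hzero
  obtain ⟨M, hM0, hM⟩ := h.exists_norm_le
  set R := max (M + 1) (‖q‖ + 1) with hRdef
  have hR : ∀ φ, ‖γ φ‖ < R := fun φ => by
    obtain ⟨y, hy, hyφ⟩ := h.exists_mem_Ico φ
    rw [hyφ]
    exact ((hM y (Ico_subset_Icc_self hy)).1.trans_lt (lt_add_one M)).trans_le (le_max_left _ _)
  have hqR : q ∈ Metric.ball (0:ℂ) R := by
    rw [mem_ball_zero_iff]
    exact (lt_add_one _).trans_le (le_max_right _ _)
  have hintegrable := h.integrableOn_cauchyLoop R
  have him : ∫ p in Metric.ball (0:ℂ) R, (cauchyLoop γ p).im * c.im = 0 := by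
    rw [integral_mul_const]
    have := integral_im hintegrable
    simp only [RCLike.im_to_complex] at this
    rw [this, h.integral_cauchyLoop hR, Complex.im_ofReal_mul, hzero, mul_zero, zero_mul]
  have hae : ∀ᵐ p ∂volume.restrict (Metric.ball (0:ℂ) R), ∀ φ, γ φ ≠ p := by
    refine ae_restrict_of_ae ?_
    filter_upwards [compl_mem_ae_iff.2 h.volume_range] with p hp φ hφ
    exact hp ⟨φ, hφ⟩
  have himint : IntegrableOn (fun p => (cauchyLoop γ p).im * c.im) (Metric.ball 0 R) :=
    hintegrable.im.mul_const _
  rw [setIntegral_eq_zero_iff_of_nonneg_ae ?_ himint] at him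
  · rw [EventuallyEq, ae_restrict_iff' measurableSet_ball] at him
    obtain ⟨U, hU, hUo, hqU⟩ := mem_nhds_iff.1
      ((h.eventually_cauchyLoop_eq hq).and (Metric.isOpen_ball.mem_nhds hqR))
    refine (hUo.measure_pos volume ⟨q, hqU⟩).ne' (measure_mono_null (fun p hp => ?_)
      (ae_iff.1 him))
    simp only [mem_ofPred_eq, not_forall]
    refine ⟨(hU hp).2, ?_⟩
    rw [(hU hp).1, hqc]
    exact mul_ne_zero hc hc
  · filter_upwards [hae] with p hp
    rcases hval p hp with h1 | h1 <;> simp [h1, mul_self_nonneg]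

lemma integral_area_ne_zero (h : IsSimpleLoop γ) :
    ∫ φ in (0:ℝ)..(2 * π), ((starRingEnd ℂ) (γ φ) * deriv γ φ).im ≠ 0 := by
  obtain ⟨ε, hε, htube⟩ := h.exists_normalPoint_ne
  have h0mem : (0:ℝ) ∈ Icc (0:ℝ) (2 * π) := by simp [Real.pi_nonneg]
  have hs₀ : 0 < ε / 2 := half_pos hε
  have hs₀ε : ε / 2 < ε := half_lt_self hε
  have hjump := h.cauchyLoop_sub_eq htube hs₀ hs₀ε
  have habs : |ε / 2| < ε := by rwa [abs_of_pos hs₀]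
  have hc := h.contDiff.continuous
  have hc' := h.contDiff_deriv.continuous
  rw [integral_im_eq (by fun_prop)]
  rcases h.cauchyLoop_eq_zero_or htube hs₀ hs₀ε with h0 | h0
  · rw [h0, zero_sub] at hjump
    refine h.integral_area_ne_zero_of_cauchyLoop (c := -(2 * π * Complex.I))
      (by simp [Real.pi_ne_zero])
      (fun p hp => ?_) (htube 0 h0mem (-(ε / 2)) (by simp [hε.ne']) (by rwa [abs_neg]))
      (by rw [← hjump, neg_neg])
    simpa [h0, ← hjump] using h.cauchyLoop_eq_or htube hs₀ hs₀ε hp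
  · rw [h0, sub_zero] at hjump
    refine h.integral_area_ne_zero_of_cauchyLoop (c := 2 * π * Complex.I)
      (by simp [Real.pi_ne_zero])
      (fun p hp => ?_) (htube 0 h0mem (ε / 2) hs₀.ne' habs) hjump
    simpa [h0, hjump, or_comm] using h.cauchyLoop_eq_or htube hs₀ hs₀ε hp

end IsSimpleLoop

end Loop

/-- If the profile curves of the equivariant flow stay embedded, the initial symplectic
area A(z(·,0)) is positive and I(0) = ∫₀^{2π} f√g dφ at t = 0 is positive, then
T ≤ A(z(·,0)) / I(0). -/
theorem lifespan_bound (n : ℕ) (hn : 2 ≤ n) (T : ℝ) (z : ℝ → ℝ → ℂ)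
    (hsm : ContDiff ℝ (⊤ : ℕ∞) (fun p : ℝ × ℝ => z p.1 p.2))
    (hper : ∀ t φ, z t (φ + 2 * π) = z t φ)
    (hreg : ∀ t ∈ Ico (0:ℝ) T, ∀ φ, deriv (z t) φ ≠ 0)
    (hnz : ∀ t ∈ Ico (0:ℝ) T, ∀ φ, z t φ ≠ 0)
    (hflow : ∀ t ∈ Ico (0:ℝ) T, ∀ φ,
      deriv (fun s => z s φ) t = -(fq n (z t) φ) • nu (z t) φ)
    (hemb : ∀ t ∈ Ico (0:ℝ) T, InjOn (z t) (Ico 0 (2 * π)))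
    (hA : 0 < (1 / 2) * ∫ φ in (0:ℝ)..(2 * π), ((starRingEnd ℂ) (z 0 φ) * deriv (z 0) φ).im)
    (hI : 0 < ∫ φ in (0:ℝ)..(2 * π), fq n (z 0) φ * ‖deriv (z 0) φ‖) :
    T ≤ ((1 / 2) * ∫ φ in (0:ℝ)..(2 * π), ((starRingEnd ℂ) (z 0 φ) * deriv (z 0) φ).im) /
        (∫ φ in (0:ℝ)..(2 * π), fq n (z 0) φ * ‖deriv (z 0) φ‖) := by
  set A := ∫ φ in (0:ℝ)..(2 * π), ((starRingEnd ℂ) (z 0 φ) * deriv (z 0) φ).im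
  set J := ∫ φ in (0:ℝ)..(2 * π), fq n (z 0) φ * ‖deriv (z 0) φ‖
  by_contra! hlt
  set b := (1 / 2) * A / J with hb
  have hb0 : 0 ≤ b := (div_pos hA hI).le
  have hsub : ∀ t ∈ Icc 0 b, t ∈ Ico 0 T := fun t ht => ⟨ht.1, ht.2.trans_lt hlt⟩
  have hbI : b ∈ Ico 0 T := ⟨hb0, hlt⟩
  have h := integral_area_sub n hb0 hsm hper (fun t ht => hreg t (hsub t ht))
    (fun t ht => hnz t (hsub t ht)) (fun t ht => hflow t (hsub t ht))
  have hloop : IsSimpleLoop (z b) :=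
    ⟨contDiff_uncurry_right hsm b, hper b, hreg b hbI, hemb b hbI⟩
  refine hloop.integral_area_ne_zero ?_
  have hbJ : b * J = 1 / 2 * A := div_mul_cancel₀ _ hI.ne'
  linarith
end
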